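/- Let φ ∈ K(z) have degree d ≥ 2. Suppose that for some n ≥ 1 the iterate φⁿ has semistable reduction and the resultant iteration formula R_{φⁿ} = N_n · R_φ holds, where N_n = dⁿ(dⁿ−1)/(d(d−1)). Then φ itself has semistable reduction; consequently the minimal resultant iteration formula R_{[φⁿ]} = N_n · R_{[φ]} holds for this n. -/

import Mathlib

open MvPolynomial Matrix

noncomputable section

variable {R : Type*} [CommRing R]

def coeffVec (e : ℕ) (F : MvPolynomial (Fin 2) R) (i : Fin (e + 1)) : R :=
  MvPolynomial.coeff (Finsupp.single 0 (e - (i : ℕ)) + Finsupp.single 1 (i : ℕ)) F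

def sylv (e : ℕ) (a b : Fin (e + 1) → R) : Matrix (Fin (e + e)) (Fin (e + e)) R :=
  Matrix.of fun i j =>
    if h : (i : ℕ) < e then
      if hj : (i : ℕ) ≤ (j : ℕ) ∧ (j : ℕ) ≤ (i : ℕ) + e then
        a ⟨(j : ℕ) - (i : ℕ), by omega⟩ else 0
    else
      if hj : (i : ℕ) - e ≤ (j : ℕ) ∧ (j : ℕ) ≤ (i : ℕ) then
        b ⟨(j : ℕ) - ((i : ℕ) - e), by omega⟩ else 0

def bres (e : ℕ) (F G : MvPolynomial (Fin 2) R) : R :=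
  (sylv e (coeffVec e F) (coeffVec e G)).det

def comp2 (F f g : MvPolynomial (Fin 2) R) : MvPolynomial (Fin 2) R :=
  MvPolynomial.aeval ![f, g] F

def pairIter (F G : MvPolynomial (Fin 2) R) : ℕ → MvPolynomial (Fin 2) R × MvPolynomial (Fin 2) R
  | 0 => (X 0, X 1)
  | n + 1 => (comp2 F (pairIter F G n).1 (pairIter F G n).2,
              comp2 G (pairIter F G n).1 (pairIter F G n).2)

variable (K : Type) [NontriviallyNormedField K] [IsUltrametricDist K]

def ordv (x : K) : ℝ := -Real.log ‖x‖

def intRing : Subring K where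
  carrier := {x : K | ‖x‖ ≤ 1}
  one_mem' := by simp
  zero_mem' := by simp
  mul_mem' := by
    intro a b ha hb
    simp only [Set.mem_setOf_eq] at *
    calc ‖a * b‖ = ‖a‖ * ‖b‖ := norm_mul a b
    _ ≤ 1 * 1 := by gcongr
    _ = 1 := by ring
  add_mem' := by
    intro a b ha hb
    simp only [Set.mem_setOf_eq] at *
    exact (IsUltrametricDist.norm_add_le_max a b).trans (max_le ha hb)
  neg_mem' := by
    intro a ha
    simp only [Set.mem_setOf_eq, norm_neg] at *
    exact ha

def maxIdl : Ideal (intRing K) where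
  carrier := {x | ‖(x : K)‖ < 1}
  zero_mem' := by simp
  add_mem' := by
    intro a b ha hb
    simp only [Set.mem_setOf_eq] at *
    exact lt_of_le_of_lt (IsUltrametricDist.norm_add_le_max (a : K) b) (max_lt ha hb)
  smul_mem' := by
    intro c x hx
    simp only [Set.mem_setOf_eq] at *
    calc ‖((c • x : intRing K) : K)‖ = ‖(c : K)‖ * ‖(x : K)‖ := norm_mul _ _
    _ ≤ 1 * ‖(x : K)‖ := by gcongr; exact c.2
    _ < 1 := by simpa using hx

def kk := intRing K ⧸ maxIdl K

instance : CommRing (kk K) := Ideal.Quotient.commRing (maxIdl K)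

def redCoeff (x : K) : kk K :=
  if h : ‖x‖ ≤ 1 then Ideal.Quotient.mk (maxIdl K) ⟨x, h⟩ else 0

def redPoly (F : MvPolynomial (Fin 2) K) : MvPolynomial (Fin 2) (kk K) :=
  ∑ m ∈ F.support, MvPolynomial.monomial m (redCoeff K (F.coeff m))

/-- A pair of binary forms is a (homogeneous) lift of a degree-`d` rational map if both entries
are homogeneous of degree `d` and they are coprime. -/
def LiftPair (d : ℕ) (F G : MvPolynomial (Fin 2) K) : Prop :=
  F.IsHomogeneous d ∧ G.IsHomogeneous d ∧ IsRelPrime F G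

/-- A pair of binary forms is normalized if all coefficients lie in `O`
and some coefficient has absolute value `1`. -/
def Normalized (F G : MvPolynomial (Fin 2) K) : Prop :=
  (∀ m, ‖F.coeff m‖ ≤ 1) ∧ (∀ m, ‖G.coeff m‖ ≤ 1) ∧
    (∃ m, ‖F.coeff m‖ = 1 ∨ ‖G.coeff m‖ = 1)

/-- The maximum of the absolute values of the coefficients of a pair of degree-`e` binary forms. -/
def maxNorm (e : ℕ) (F G : MvPolynomial (Fin 2) K) : ℝ :=
  Finset.univ.sup' Finset.univ_nonempty
    (fun i : Fin (e + 1) => max ‖coeffVec e F i‖ ‖coeffVec e G i‖)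

/-- `Rpair e F G` is the quantity `R_φ = ord(Res(F₀,G₀))` where `(F₀,G₀)` is the normalized
rescaling of the pair `(F,G)` of degree-`e` binary forms; equivalently it is
`ord(Res(F,G)) - 2·e·(minimal ord of a coefficient of F, G)`. -/
def Rpair (e : ℕ) (F G : MvPolynomial (Fin 2) K) : ℝ :=
  ordv K (bres e F G) + 2 * e * Real.log (maxNorm K e F G)

/-- Linear substitution of a `2×2` matrix into a binary form. -/
def mobius (M : Matrix (Fin 2) (Fin 2) K) (F : MvPolynomial (Fin 2) K) :
    MvPolynomial (Fin 2) K :=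
  MvPolynomial.aeval
    ![C (M 0 0) * X 0 + C (M 0 1) * X 1, C (M 1 0) * X 0 + C (M 1 1) * X 1] F

/-- The conjugate pair `γ⁻¹ ∘ (F,G) ∘ γ`, a homogeneous lift of `φ^γ = γ⁻¹ ∘ φ ∘ γ`. -/
def conjPair (M : GL (Fin 2) K) (F G : MvPolynomial (Fin 2) K) :
    MvPolynomial (Fin 2) K × MvPolynomial (Fin 2) K :=
  (C ((M⁻¹ : GL (Fin 2) K) 0 0) * mobius K M F + C ((M⁻¹ : GL (Fin 2) K) 0 1) * mobius K M G,
   C ((M⁻¹ : GL (Fin 2) K) 1 0) * mobius K M F + C ((M⁻¹ : GL (Fin 2) K) 1 1) * mobius K M G)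

/-- The minimal resultant `R_{[φ]} = inf_γ R_{φ^γ}` of (the map lifted by) a degree-`e` pair. -/
def Rmin (e : ℕ) (F G : MvPolynomial (Fin 2) K) : ℝ :=
  ⨅ M : GL (Fin 2) K, Rpair K e (conjPair K M F G).1 (conjPair K M F G).2

/-- `Ilocus d F G` says the reduction of the normalized pair `(F,G)` lies in the indeterminacy
locus `I(d)`: the reduced pair is proportional, i.e. `(F̃, G̃) = (a·C, b·C)` with `[a:b] ∈ P¹(k)`
(so that the residue map is the constant `[a:b]`), and the constant value `[a:b]`
is a root of the common factor `C` (which is the gcd `Ã` of `F̃` and `G̃`). -/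
def Ilocus (d : ℕ) (F G : MvPolynomial (Fin 2) K) : Prop :=
  ∃ (a b : kk K) (Cf : MvPolynomial (Fin 2) (kk K)),
    ¬(a = 0 ∧ b = 0) ∧ Cf.IsHomogeneous d ∧
    redPoly K F = MvPolynomial.C a * Cf ∧ redPoly K G = MvPolynomial.C b * Cf ∧
    MvPolynomial.eval ![a, b] Cf = 0

/-- `Semistable d F G` says the reduction of the normalized pair `(F,G)` is GIT-semistable
(Silverman's numerical criterion): writing `F̃ = Ã·F̃₀`, `G̃ = Ã·G̃₀` with `F̃₀, G̃₀` coprime,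
every root `h = [a:b]` of `Ã` has multiplicity `r ≤ d/2` (`d` even), resp. `r ≤ (d+1)/2`
(`d` odd), and when the bound is attained additionally `φ̃(h) ≠ h`. -/
def Semistable (d : ℕ) (F G : MvPolynomial (Fin 2) K) : Prop :=
  ∃ (A F0 G0 : MvPolynomial (Fin 2) (kk K)) (e : ℕ),
    e ≤ d ∧ A.IsHomogeneous (d - e) ∧ F0.IsHomogeneous e ∧ G0.IsHomogeneous e ∧
    redPoly K F = A * F0 ∧ redPoly K G = A * G0 ∧ IsRelPrime F0 G0 ∧
    ∀ (a b : kk K), ¬(a = 0 ∧ b = 0) → ∀ r : ℕ,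
      (MvPolynomial.C b * X 0 - MvPolynomial.C a * X 1) ^ r ∣ A →
        2 * r ≤ d + 1 ∧
          (d ≤ 2 * r →
            b * MvPolynomial.eval ![a, b] F0 ≠ a * MvPolynomial.eval ![a, b] G0)

/-- The rational map lifted by the (not necessarily normalized) pair `(F,G)` has semistable
reduction: some normalized rescaling is `Semistable`. -/
def HasSemistableRed (d : ℕ) (F G : MvPolynomial (Fin 2) K) : Prop :=
  ∃ c : Kˣ, Normalized K ((c : K) • F) ((c : K) • G) ∧
    Semistable K d ((c : K) • F) ((c : K) • G)

/-- The reduction of (a normalized rescaling of) the pair `(F,G)` lies outside `I(d)`. -/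
def RedOutsideI (d : ℕ) (F G : MvPolynomial (Fin 2) K) : Prop :=
  ∃ c : Kˣ, Normalized K ((c : K) • F) ((c : K) • G) ∧
    ¬ Ilocus K d ((c : K) • F) ((c : K) • G)

/-- The `m`-th term (`m ≥ 1`) of Tate's series `x(w)`. -/
def tateTerm (q w : K) (m : ℕ) : K :=
  q ^ m * w / (1 - q ^ m * w) ^ 2 + q ^ m * w⁻¹ / (1 - q ^ m * w⁻¹) ^ 2
    - 2 * (q ^ m / (1 - q ^ m) ^ 2)

/-- Tate's series `x(w)` for the Tate curve with parameter `q`. -/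
def xTate (q w : K) : K :=
  w / (1 - w) ^ 2 + ∑' m : ℕ, tateTerm K q w (m + 1)


section BinaryForms

variable {S : Type*} [CommRing S]

lemma aeval_mul_of_isHomogeneous {A : Type*} [CommRing A] [Algebra S A]
    {H : MvPolynomial (Fin 2) S} {m : ℕ} (hH : H.IsHomogeneous m) (p f g : A) :
    aeval ![p * f, p * g] H = p ^ m * aeval ![f, g] H := by
  simp only [aeval_def, eval₂_eq', Finset.mul_sum, Fin.prod_univ_two, Matrix.cons_val_zero,
    Matrix.cons_val_one]
  refine Finset.sum_congr rfl fun x hx => ?_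
  have h := hH (mem_support_iff.mp hx)
  rw [Finsupp.weight_apply, Finsupp.sum_fintype _ _ (by simp)] at h
  simp only [Fin.sum_univ_two, Pi.one_apply, smul_eq_mul, mul_one] at h
  rw [← h]
  ring

lemma isHomogeneous_exponent_sum {H : MvPolynomial (Fin 2) S} {m : ℕ} (hH : H.IsHomogeneous m)
    {x : Fin 2 →₀ ℕ} (hx : H.coeff x ≠ 0) : x 0 + x 1 = m := by
  have h := hH hx
  rw [Finsupp.weight_apply, Finsupp.sum_fintype _ _ (by simp)] at h
  simpa using h

lemma isHomogeneous_comp2 {F f g : MvPolynomial (Fin 2) S} {d e : ℕ} (hF : F.IsHomogeneous d)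
    (hf : f.IsHomogeneous e) (hg : g.IsHomogeneous e) : (comp2 F f g).IsHomogeneous (e * d) := by
  refine hF.aeval _ fun i => ?_
  fin_cases i
  · exact hf
  · exact hg

lemma isHomogeneous_pairIter {F G : MvPolynomial (Fin 2) S} {d : ℕ} (hF : F.IsHomogeneous d)
    (hG : G.IsHomogeneous d) (n : ℕ) :
    (pairIter F G n).1.IsHomogeneous (d ^ n) ∧ (pairIter F G n).2.IsHomogeneous (d ^ n) := by
  induction n with
  | zero => exact ⟨isHomogeneous_X _ _, isHomogeneous_X _ _⟩
  | succ n ih => exact ⟨isHomogeneous_comp2 hF ih.1 ih.2, isHomogeneous_comp2 hG ih.1 ih.2⟩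

lemma map_comp2 {T : Type*} [CommRing T] (φ : S →+* T) (F f g : MvPolynomial (Fin 2) S) :
    map φ (comp2 F f g) = comp2 (map φ F) (map φ f) (map φ g) := by
  induction F using MvPolynomial.induction_on with
  | C a => simp [comp2]
  | add p q hp hq => simp_all [comp2]
  | mul_X p i hp =>
    simp only [comp2, map_mul, aeval_X, map_X] at hp ⊢
    rw [hp]
    fin_cases i <;> rfl

lemma map_pairIter {T : Type*} [CommRing T] (φ : S →+* T) (F G : MvPolynomial (Fin 2) S) (n : ℕ) :
    map φ (pairIter F G n).1 = (pairIter (map φ F) (map φ G) n).1 ∧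
      map φ (pairIter F G n).2 = (pairIter (map φ F) (map φ G) n).2 := by
  induction n with
  | zero => simp [pairIter]
  | succ n ih => simp [pairIter, map_comp2, ih]

/-- The linear form vanishing at the point `[a : b]`. -/
def pointForm (a b : S) : MvPolynomial (Fin 2) S := C b * X 0 - C a * X 1

lemma isHomogeneous_pointForm (a b : S) : (pointForm a b).IsHomogeneous 1 :=
  ((isHomogeneous_X _ _).C_mul _).sub ((isHomogeneous_X _ _).C_mul _)

lemma eval_pointForm (a b : S) : eval ![a, b] (pointForm a b) = 0 := by
  simp [pointForm, mul_comm]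

/-- A pair of binary forms of degree `d` is unstable at `[a : b]`: the point is a fixed point or a
root of the common factor whose multiplicity violates the semistability bound. -/
def UnstableAt (d : ℕ) (F G : MvPolynomial (Fin 2) S) (a b : S) (r : ℕ) : Prop :=
  d ≤ 2 * r ∧ pointForm a b ^ r ∣ F ∧ pointForm a b ^ r ∣ G ∧
    pointForm a b ^ (r + 1) ∣ C b * F - C a * G

/-- A pair of binary forms fails the numerical criterion for semistability. -/
def Unstable (d : ℕ) (F G : MvPolynomial (Fin 2) S) : Prop :=
  ∃ a b r, ¬(a = 0 ∧ b = 0) ∧ UnstableAt d F G a b r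

end BinaryForms

section Field

variable {k : Type*} [Field k]

lemma isHomogeneous_of_mul {P Q : MvPolynomial (Fin 2) k} {d : ℕ} (h : (P * Q).IsHomogeneous d)
    (h0 : P * Q ≠ 0) : P.IsHomogeneous P.totalDegree := by
  obtain ⟨hP0, hQ0⟩ := mul_ne_zero_iff.mp h0
  have key : ∀ P : MvPolynomial (Fin 2) k, P ≠ 0 →
      (P : MvPowerSeries (Fin 2) k).order ≤ P.totalDegree := by
    intro P hP
    obtain ⟨m, hm⟩ := MvPolynomial.ne_zero_iff.mp hP
    refine (MvPowerSeries.order_le (d := m) (by simpa using hm)).trans ?_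
    exact_mod_cast MvPolynomial.le_totalDegree (mem_support_iff.mpr hm)
  have hPQ : (d : ℕ∞) ≤ ((P * Q : MvPolynomial (Fin 2) k) : MvPowerSeries (Fin 2) k).order := by
    refine MvPowerSeries.le_order fun m hm => ?_
    rw [MvPolynomial.coeff_coe]
    refine h.coeff_eq_zero fun e => ?_
    rw [e] at hm
    exact lt_irrefl _ hm
  rw [MvPolynomial.coe_mul, MvPowerSeries.order_mul] at hPQ
  have hd : P.totalDegree + Q.totalDegree = d := by
    rw [← totalDegree_mul_of_isDomain hP0 hQ0, h.totalDegree h0]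
  have hQ := key Q hQ0
  have hP : (P.totalDegree : ℕ∞) ≤ (P : MvPowerSeries (Fin 2) k).order := by
    by_contra! hlt
    have : (P : MvPowerSeries (Fin 2) k).order + (Q : MvPowerSeries (Fin 2) k).order < d := by
      rw [← hd]
      push_cast
      exact ENat.add_lt_add_of_lt_of_le (ne_top_of_le_ne_top (ENat.natCast_ne_top _) hQ) hlt hQ
    exact absurd hPQ (not_le.mpr this)
  intro m hm
  have h1 : m.degree ≤ P.totalDegree := MvPolynomial.le_totalDegree (mem_support_iff.mpr hm)
  have h2 : (P : MvPowerSeries (Fin 2) k).order ≤ m.degree :=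
    MvPowerSeries.order_le (by simpa using hm)
  have h3 : P.totalDegree ≤ m.degree := by exact_mod_cast hP.trans h2
  exact (DFunLike.congr_fun Finsupp.degree_eq_weight_one m).symm.trans (le_antisymm h1 h3)

lemma exists_pow_mul_of_dvd {F : MvPolynomial (Fin 2) k} {d r : ℕ} (hF : F.IsHomogeneous d)
    {a b : k} (h : pointForm a b ^ r ∣ F) :
    F = 0 ∨ ∃ m F', r + m = d ∧ F'.IsHomogeneous m ∧ F = pointForm a b ^ r * F' := by
  by_cases h0 : F = 0
  · exact Or.inl h0
  obtain ⟨F', rfl⟩ := h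
  refine Or.inr ⟨F'.totalDegree, F', ?_, ?_, rfl⟩
  · have hp := (isHomogeneous_pointForm a b).pow r
    have h1 := isHomogeneous_of_mul (P := F') (by rwa [mul_comm] at hF) (by rwa [mul_comm] at h0)
    exact (one_mul r ▸ (hp.mul h1).inj_right hF h0 :)
  · exact isHomogeneous_of_mul (by rwa [mul_comm] at hF) (by rwa [mul_comm] at h0)

lemma pow_dvd_comp2 {H f g : MvPolynomial (Fin 2) k} {d r s : ℕ} (hH : H.IsHomogeneous d)
    {a b : k} (hr : pointForm a b ^ r ∣ H) (hf : pointForm a b ^ s ∣ f)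
    (hg : pointForm a b ^ s ∣ g) (hfg : pointForm a b ^ (s + 1) ∣ C b * f - C a * g) :
    pointForm a b ^ (s * d + r) ∣ comp2 H f g := by
  obtain rfl | ⟨m, H', rfl, hH', rfl⟩ := exists_pow_mul_of_dvd hH hr
  · simp [comp2]
  have h1 : comp2 (pointForm a b ^ r * H') f g = (C b * f - C a * g) ^ r * comp2 H' f g := by
    simp [comp2, pointForm, algebraMap_eq]
  obtain ⟨f', rfl⟩ := hf
  obtain ⟨g', rfl⟩ := hg
  rw [h1, show s * (r + m) + r = (s + 1) * r + s * m by ring, pow_add, pow_mul, pow_mul]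
  refine mul_dvd_mul (pow_dvd_pow_of_dvd hfg _) ?_
  rw [comp2, aeval_mul_of_isHomogeneous hH']
  exact Dvd.intro _ rfl

lemma UnstableAt.pairIter {F G : MvPolynomial (Fin 2) k} {d r : ℕ} (hF : F.IsHomogeneous d)
    (hG : G.IsHomogeneous d) {a b : k} (h : UnstableAt d F G a b r) (n : ℕ) :
    ∃ s, UnstableAt (d ^ (n + 1)) (pairIter F G (n + 1)).1 (pairIter F G (n + 1)).2 a b s := by
  obtain ⟨hdr, h1, h2, h3⟩ := h
  have hC : (C b * F - C a * G).IsHomogeneous d := (hF.C_mul _).sub (hG.C_mul _)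
  have step : ∀ (D s : ℕ) (f g : MvPolynomial (Fin 2) k), D ≤ 2 * s + 1 →
      pointForm a b ^ s ∣ f → pointForm a b ^ s ∣ g →
      pointForm a b ^ (s + 1) ∣ C b * f - C a * g →
      UnstableAt (D * d) (comp2 F f g) (comp2 G f g) a b (s * d + r) := by
    intro D s f g hD hf hg hfg
    refine ⟨by nlinarith, pow_dvd_comp2 hF h1 hf hg hfg, pow_dvd_comp2 hG h2 hf hg hfg, ?_⟩
    have := pow_dvd_comp2 hC h3 hf hg hfg
    simpa [comp2, algebraMap_eq, add_assoc] using this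
  induction n with
  | zero =>
    refine ⟨0 * d + r, ?_⟩
    rw [pow_succ]
    exact step (d ^ 0) 0 (X 0) (X 1) (by simp) (by simp) (by simp) (by simp [pointForm])
  | succ n ih =>
    obtain ⟨s, hs, hf, hg, hfg⟩ := ih
    refine ⟨s * d + r, ?_⟩
    rw [pow_succ]
    exact step _ s _ _ (by omega) hf hg hfg

lemma Unstable.pairIter {F G : MvPolynomial (Fin 2) k} {d : ℕ} (hF : F.IsHomogeneous d)
    (hG : G.IsHomogeneous d) (h : Unstable d F G) {n : ℕ} (hn : 1 ≤ n) :
    Unstable (d ^ n) (pairIter F G n).1 (pairIter F G n).2 := by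
  obtain ⟨n, rfl⟩ := Nat.exists_eq_add_of_le' hn
  obtain ⟨a, b, r, hab, h⟩ := h
  obtain ⟨s, hs⟩ := h.pairIter hF hG n
  exact ⟨a, b, s, hab, hs⟩

lemma prime_pointForm {a b : k} (hab : ¬(a = 0 ∧ b = 0)) : Prime (pointForm a b) := by
  have h0 : pointForm a b ≠ 0 := by
    intro h
    have h1 := congrArg (eval ![1, 0]) h
    have h2 := congrArg (eval ![0, 1]) h
    simp [pointForm] at h1 h2
    exact hab ⟨h2, h1⟩
  refine (irreducible_of_totalDegree_eq_one ((isHomogeneous_pointForm a b).totalDegree h0)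
    fun x hx => ?_).prime
  rw [isUnit_iff_ne_zero]
  rintro rfl
  exact h0 (MvPolynomial.ext _ _ fun m => by simpa using hx m)

lemma pointForm_dvd_of_eval_eq_zero {F : MvPolynomial (Fin 2) k} {d : ℕ} (hF : F.IsHomogeneous d)
    {a b : k} (hab : ¬(a = 0 ∧ b = 0)) (h : eval ![a, b] F = 0) : pointForm a b ∣ F := by
  rw [← Ideal.mem_span_singleton, ← Ideal.Quotient.eq_zero_iff_mem]
  set I := Ideal.span {pointForm a b}
  set q := Ideal.Quotient.mkₐ k I with hq
  have hp : q (pointForm a b) = 0 := by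
    rw [hq, Ideal.Quotient.mkₐ_eq_mk, Ideal.Quotient.eq_zero_iff_mem]
    exact Ideal.mem_span_singleton_self _
  obtain ⟨w, h0, h1⟩ : ∃ w, q (X 0) = w * algebraMap k _ a ∧ q (X 1) = w * algebraMap k _ b := by
    have hrel : algebraMap k _ b * q (X 0) = algebraMap k _ a * q (X 1) := by
      have : q (C b * X 0 - C a * X 1) = 0 := hp
      rw [map_sub, map_mul, map_mul, sub_eq_zero] at this
      rw [← AlgHom.commutes q, ← AlgHom.commutes q]
      exact this
    by_cases hb : b = 0
    · have ha : a ≠ 0 := fun ha => hab ⟨ha, hb⟩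
      have hi : algebraMap k (MvPolynomial (Fin 2) k ⧸ I) a⁻¹ * algebraMap k _ a = 1 := by
        rw [← map_mul, inv_mul_cancel₀ ha, map_one]
      refine ⟨algebraMap k _ a⁻¹ * q (X 0), by linear_combination (-q (X 0)) * hi, ?_⟩
      linear_combination (-q (X 1)) * hi - algebraMap k _ a⁻¹ * hrel
    · have hi : algebraMap k (MvPolynomial (Fin 2) k ⧸ I) b⁻¹ * algebraMap k _ b = 1 := by
        rw [← map_mul, inv_mul_cancel₀ hb, map_one]
      refine ⟨algebraMap k _ b⁻¹ * q (X 1), ?_, by linear_combination (-q (X 1)) * hi⟩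
      linear_combination (-q (X 0)) * hi + algebraMap k _ b⁻¹ * hrel
  have h2 : q F = aeval ![w * algebraMap k _ a, w * algebraMap k _ b] F := by
    have : q = aeval ![w * algebraMap k _ a, w * algebraMap k _ b] := by
      ext i
      fin_cases i
      · simpa using h0
      · simpa using h1
    rw [this]
  change q F = 0
  rw [h2, aeval_mul_of_isHomogeneous hF]
  have h3 : aeval ![algebraMap k (MvPolynomial (Fin 2) k ⧸ I) a, algebraMap k _ b] F =
      algebraMap k _ (eval ![a, b] F) := by
    rw [← MvPolynomial.coe_aeval_eq_eval, RingHom.coe_coe, ← aeval_algebraMap_apply]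
    congr 2
    ext i
    fin_cases i <;> rfl
  rw [h3, h, map_zero, mul_zero]

lemma exists_relPrime_decomposition {F G : MvPolynomial (Fin 2) k} {d : ℕ}
    (hF : F.IsHomogeneous d) (hG : G.IsHomogeneous d) :
    ∃ (A F0 G0 : MvPolynomial (Fin 2) k) (e : ℕ), e ≤ d ∧ A.IsHomogeneous (d - e) ∧
      F0.IsHomogeneous e ∧ G0.IsHomogeneous e ∧ F = A * F0 ∧ G = A * G0 ∧ IsRelPrime F0 G0 := by
  have aux : ∀ F G : MvPolynomial (Fin 2) k, F.IsHomogeneous d → G.IsHomogeneous d → G ≠ 0 →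
      ∃ (A F0 G0 : MvPolynomial (Fin 2) k) (e : ℕ), e ≤ d ∧ A.IsHomogeneous (d - e) ∧
      F0.IsHomogeneous e ∧ G0.IsHomogeneous e ∧ F = A * F0 ∧ G = A * G0 ∧ IsRelPrime F0 G0 := by
    intro F G hF hG hG0
    obtain ⟨F0, G0, A, hrel, rfl, rfl⟩ :=
      UniqueFactorizationMonoid.exists_reduced_factors' F G hG0
    have hA := isHomogeneous_of_mul hG hG0
    have hG1 := isHomogeneous_of_mul (P := G0) (Q := A) (by rwa [mul_comm] at hG)
      (by rwa [mul_comm] at hG0)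
    have hd := (hA.mul hG1).inj_right hG hG0
    refine ⟨A, F0, G0, G0.totalDegree, by omega, ?_, ?_, hG1, rfl, rfl, hrel⟩
    · rwa [← hd, Nat.add_sub_cancel]
    · by_cases hF0 : F0 = 0
      · rw [hF0]
        exact isHomogeneous_zero _ _ _
      · have hA0 := (mul_ne_zero_iff.mp hG0).1
        have hF1 := isHomogeneous_of_mul (P := F0) (Q := A) (by rwa [mul_comm] at hF)
          (by simp [hF0, hA0])
        have := (hA.mul hF1).inj_right hF (by simp [hF0, hA0])
        rwa [show G0.totalDegree = F0.totalDegree by omega]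
  by_cases hG0 : G = 0
  · by_cases hF0 : F = 0
    · refine ⟨0, 1, 1, 0, by omega, isHomogeneous_zero _ _ _, isHomogeneous_one _ _,
        isHomogeneous_one _ _, by simp [hF0], by simp [hG0], isRelPrime_one_left⟩
    · obtain ⟨A, F0, G0, e, h1, h2, h3, h4, h5, h6, h7⟩ := aux G F hG hF hF0
      exact ⟨A, G0, F0, e, h1, h2, h4, h3, h6, h5, h7.symm⟩
  · exact aux F G hF hG hG0

/-- The semistability condition at every point, for a pair of forms over a field. -/
lemma exists_semistable_decomposition {F G : MvPolynomial (Fin 2) k} {d : ℕ}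
    (hF : F.IsHomogeneous d) (hG : G.IsHomogeneous d) (h : ¬Unstable d F G) :
    ∃ (A F0 G0 : MvPolynomial (Fin 2) k) (e : ℕ), e ≤ d ∧ A.IsHomogeneous (d - e) ∧
      F0.IsHomogeneous e ∧ G0.IsHomogeneous e ∧ F = A * F0 ∧ G = A * G0 ∧ IsRelPrime F0 G0 ∧
      ∀ (a b : k), ¬(a = 0 ∧ b = 0) → ∀ r : ℕ, (C b * X 0 - C a * X 1) ^ r ∣ A →
        2 * r ≤ d + 1 ∧ (d ≤ 2 * r → b * eval ![a, b] F0 ≠ a * eval ![a, b] G0) := by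
  obtain ⟨A, F0, G0, e, h1, h2, h3, h4, rfl, rfl, h7⟩ := exists_relPrime_decomposition hF hG
  refine ⟨A, F0, G0, e, h1, h2, h3, h4, rfl, rfl, h7, fun a b hab r hr => ⟨?_, ?_⟩⟩
  · by_contra! hlt
    obtain ⟨r, rfl⟩ : ∃ r', r = r' + 1 := ⟨r - 1, by omega⟩
    have hr' : pointForm a b ^ r ∣ A := (pow_dvd_pow _ (Nat.le_succ r)).trans hr
    refine h ⟨a, b, r, hab, by omega, hr'.mul_right _, hr'.mul_right _, ?_⟩
    rw [show C b * (A * F0) - C a * (A * G0) = A * (C b * F0 - C a * G0) by ring]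
    exact hr.mul_right _
  · intro hd heq
    refine h ⟨a, b, r, hab, hd, hr.mul_right _, hr.mul_right _, ?_⟩
    rw [show C b * (A * F0) - C a * (A * G0) = A * (C b * F0 - C a * G0) by ring, pow_succ]
    refine mul_dvd_mul hr (pointForm_dvd_of_eval_eq_zero (d := e)
      ((h3.C_mul _).sub (h4.C_mul _)) hab ?_)
    simp [heq]

lemma not_unstable_of_decomposition {A F0 G0 : MvPolynomial (Fin 2) k} {d : ℕ}
    (hrel : IsRelPrime F0 G0)
    (h : ∀ (a b : k), ¬(a = 0 ∧ b = 0) → ∀ r : ℕ, (C b * X 0 - C a * X 1) ^ r ∣ A →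
        2 * r ≤ d + 1 ∧ (d ≤ 2 * r → b * eval ![a, b] F0 ≠ a * eval ![a, b] G0)) :
    ¬Unstable d (A * F0) (A * G0) := by
  rintro ⟨a, b, r, hab, hd, hF, hG, hFG⟩
  have hp := prime_pointForm hab
  have hr : pointForm a b ^ r ∣ A := by
    by_cases h1 : pointForm a b ∣ F0
    · exact hp.pow_dvd_of_dvd_mul_right r (fun h2 => hp.not_isUnit (hrel h1 h2)) hG
    · exact hp.pow_dvd_of_dvd_mul_right r h1 hF
  have hr1 : ¬pointForm a b ^ (r + 1) ∣ A := fun h1 => by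
    have := (h a b hab (r + 1) h1).1
    omega
  rw [show C b * (A * F0) - C a * (A * G0) = A * (C b * F0 - C a * G0) by ring] at hFG
  have h2 : pointForm a b ∣ C b * F0 - C a * G0 := by
    by_contra h3
    exact hr1 (hp.pow_dvd_of_dvd_mul_right _ h3 hFG)
  refine (h a b hab r hr).2 hd ?_
  obtain ⟨q, hq⟩ := h2
  have := congrArg (eval ![a, b]) hq
  rw [map_mul, eval_pointForm, zero_mul] at this
  simpa [sub_eq_zero] using this

end Field

section Resultant

variable {k : Type*} [Field k]

/-- Dehomogenization of a binary form at `X = 1`. -/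
def dehom : MvPolynomial (Fin 2) k →ₐ[k] Polynomial k := aeval ![1, Polynomial.X]

lemma coeff_dehom {F : MvPolynomial (Fin 2) k} {e : ℕ} (hF : F.IsHomogeneous e) (i : Fin (e + 1)) :
    (dehom F).coeff i = coeffVec e F i := by
  have hi : (i : ℕ) ≤ e := Nat.lt_succ_iff.mp i.2
  rw [coeffVec, dehom, aeval_def, eval₂_eq', Polynomial.finsetSum_coeff]
  simp only [Fin.prod_univ_two, Matrix.cons_val_zero, Matrix.cons_val_one, one_pow, one_mul,
    Polynomial.algebraMap_eq, Polynomial.coeff_C_mul_X_pow]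
  rw [Finset.sum_eq_single (Finsupp.single 0 (e - (i : ℕ)) + Finsupp.single 1 (i : ℕ))]
  · simp
  · intro m hm hne
    rw [if_neg]
    intro h
    apply hne
    have := isHomogeneous_exponent_sum hF (mem_support_iff.mp hm)
    ext j
    fin_cases j
    · simp; omega
    · simp [h]
  · intro h
    simpa using h

lemma natDegree_dehom_le {F : MvPolynomial (Fin 2) k} {e : ℕ} (hF : F.IsHomogeneous e) :
    (dehom F).natDegree ≤ e := by
  rw [dehom, aeval_def, eval₂_eq']
  refine Polynomial.natDegree_sum_le_of_forall_le _ _ fun m hm => ?_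
  simp only [Fin.prod_univ_two, Matrix.cons_val_zero, Matrix.cons_val_one, one_pow, one_mul,
    Polynomial.algebraMap_eq]
  refine (Polynomial.natDegree_C_mul_X_pow_le _ _).trans ?_
  have := isHomogeneous_exponent_sum hF (mem_support_iff.mp hm)
  omega

lemma eq_of_dehom_eq {F G : MvPolynomial (Fin 2) k} {e : ℕ} (hF : F.IsHomogeneous e)
    (hG : G.IsHomogeneous e) (h : dehom F = dehom G) : F = G := by
  ext m
  by_cases hm : m 0 + m 1 = e
  · have key : m = Finsupp.single 0 (e - m 1) + Finsupp.single 1 (m 1) := by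
      ext j
      fin_cases j
      · simp; omega
      · simp
    have h1 := coeff_dehom hF ⟨m 1, by omega⟩
    have h2 := coeff_dehom hG ⟨m 1, by omega⟩
    rw [h] at h1
    rw [key]
    exact h1.symm.trans h2
  · have aux : ∀ H : MvPolynomial (Fin 2) k, H.IsHomogeneous e → H.coeff m = 0 := fun H hH => by
      by_contra h0
      exact hm (isHomogeneous_exponent_sum hH h0)
    rw [aux F hF, aux G hG]

lemma bres_eq_resultant {F G : MvPolynomial (Fin 2) k} {e : ℕ} (hF : F.IsHomogeneous e)
    (hG : G.IsHomogeneous e) : bres e F G = (dehom G).resultant (dehom F) e e := by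
  rw [bres, Polynomial.resultant, ← Matrix.det_transpose]
  congr 1
  ext i j
  rw [Matrix.transpose_apply]
  induction j using Fin.addCases with
  | left j =>
    simp only [sylv, Matrix.of_apply, Polynomial.sylvester, Fin.addCases_left, Fin.val_castAdd,
      j.2, dif_pos, Set.mem_Icc]
    split_ifs with h
    · exact (coeff_dehom hF _).symm
    · rfl
  | right j =>
    simp only [sylv, Matrix.of_apply, Polynomial.sylvester, Fin.addCases_right, Fin.val_natAdd,
      Set.mem_Icc, add_lt_iff_neg_left, not_lt_zero, dif_neg, not_false_eq_true,
      Nat.add_sub_cancel_left]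
    have : ((j : ℕ) ≤ i ∧ (i : ℕ) ≤ e + j) ↔ ((j : ℕ) ≤ i ∧ (i : ℕ) ≤ j + e) := by omega
    split_ifs with h h' h'
    · exact (coeff_dehom hG _).symm
    · exact absurd (this.mp h) h'
    · exact absurd (this.mpr h') h
    · rfl

open Polynomial in
lemma resultant_mul_left_of_le {p q g : k[X]} {m₁ m₂ n : ℕ} (hp : p.natDegree ≤ m₁)
    (hq : q.natDegree ≤ m₂) (hg : g.natDegree ≤ n) :
    resultant (p * q) g (m₁ + m₂) n = resultant p g m₁ n * resultant q g m₂ n := by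
  obtain ⟨a, rfl⟩ := Nat.exists_eq_add_of_le hp
  obtain ⟨b, rfl⟩ := Nat.exists_eq_add_of_le hq
  rw [resultant_add_left_deg _ _ _ _ _ le_rfl, resultant_add_left_deg _ _ _ _ _ le_rfl,
    show p.natDegree + a + (q.natDegree + b) = p.natDegree + q.natDegree + (a + b) by ring,
    resultant_add_left_deg _ _ _ _ _ natDegree_mul_le, resultant_mul_left _ _ _ _ hg]
  ring

open Polynomial in
lemma resultant_prod_left_of_le {ι : Type*} (s : Finset ι) (p : ι → k[X]) {g : k[X]} {m n : ℕ}
    (hp : ∀ i ∈ s, (p i).natDegree ≤ m) (hg : g.natDegree ≤ n) :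
    resultant (∏ i ∈ s, p i) g (m * s.card) n = ∏ i ∈ s, resultant (p i) g m n := by
  classical
  induction s using Finset.induction_on with
  | empty => simp
  | insert a s ha ih =>
    rw [Finset.prod_insert ha, Finset.prod_insert ha, Finset.card_insert_of_notMem ha, mul_add,
      mul_one, add_comm (m * s.card), resultant_mul_left_of_le (hp a (by simp)) ?_ hg,
      ih fun i hi => hp i (by simp [hi])]
    refine (natDegree_prod_le _ _).trans ?_
    rw [mul_comm]
    exact Finset.sum_le_card_nsmul _ _ _ fun i hi => hp i (by simp [hi])

open Polynomial in
lemma resultant_prod_prod {ι κ : Type*} (s : Finset ι) (t : Finset κ) (p : ι → k[X]) (q : κ → k[X])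
    {m n : ℕ} (hp : ∀ i ∈ s, (p i).natDegree ≤ m) (hq : ∀ j ∈ t, (q j).natDegree ≤ n) :
    resultant (∏ i ∈ s, p i) (∏ j ∈ t, q j) (m * s.card) (n * t.card) =
      ∏ i ∈ s, ∏ j ∈ t, resultant (p i) (q j) m n := by
  rw [resultant_prod_left_of_le s p hp]
  · refine Finset.prod_congr rfl fun i hi => ?_
    rw [resultant_comm, resultant_prod_left_of_le t q hq (hp i hi)]
    simp_rw [fun j => resultant_comm (p i) (q j) m n]
    rw [Finset.prod_mul_distrib, Finset.prod_const, ← pow_mul]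
    ring_nf
  · refine (natDegree_prod_le _ _).trans ?_
    rw [mul_comm]
    exact Finset.sum_le_card_nsmul _ _ _ hq

open Polynomial in
/-- The resultant of two linear combinations of polynomials of formal degree `e`. -/
lemma resultant_linear_comb {f g : k[X]} {e : ℕ} (hf : f.natDegree ≤ e) (hg : g.natDegree ≤ e)
    (a b c d : k) :
    resultant (Polynomial.C a * f + Polynomial.C b * g) (Polynomial.C c * f + Polynomial.C d * g) e e = (a * d - b * c) ^ e *
      resultant f g e e := by
  have hC : ∀ (r : k) {p : k[X]}, p.natDegree ≤ e → (Polynomial.C r * p).natDegree ≤ e := fun r p hp =>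
    (natDegree_C_mul_le _ _).trans hp
  by_cases ha : a = 0
  · subst ha
    rw [Polynomial.C_0, zero_mul, zero_add, resultant_C_mul_left,
      show Polynomial.C c * f + Polynomial.C d * g = Polynomial.C c * f + g * Polynomial.C d by ring,
      resultant_add_mul_right _ _ _ _ _ (by simp) hg, resultant_C_mul_right, resultant_comm]
    rw [zero_mul, zero_sub, neg_pow (b * c), mul_pow]
    have : (-1 : k) ^ (e * e) = (-1) ^ e := by
      rcases Nat.even_or_odd e with h | h
      · rw [(h.mul_left e).neg_one_pow, h.neg_one_pow]
      · rw [(h.mul h).neg_one_pow, h.neg_one_pow]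
    rw [this]
    ring
  · have h1 : Polynomial.C c * f + Polynomial.C d * g =
        Polynomial.C (d - b * c / a) * g + (Polynomial.C a * f + Polynomial.C b * g) * Polynomial.C (c / a) := by
      have h2 : c = a * (c / a) := by field_simp
      have h3 : d = (d - b * c / a) + b * (c / a) := by ring
      conv_lhs => rw [h2, h3]
      simp only [Polynomial.C_mul, Polynomial.C_add]
      ring
    rw [h1, resultant_add_mul_right _ _ _ _ _ (by simp)
      ((natDegree_add_le _ _).trans (max_le (hC a hf) (hC b hg))), resultant_C_mul_right,
      show Polynomial.C a * f + Polynomial.C b * g = Polynomial.C a * f + g * Polynomial.C b by ring,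
      resultant_add_mul_left _ _ _ _ _ (by simp) hg, resultant_C_mul_left, ← mul_assoc, ← mul_pow]
    congr 2
    field_simp

open Polynomial in
lemma exists_prod_linear [IsAlgClosed k] (d : ℕ) (p : k[X]) (hp : p.natDegree ≤ d) :
    ∃ (c : k) (a b : Fin d → k), p = Polynomial.C c * ∏ i, (Polynomial.C (a i) + Polynomial.C (b i) * Polynomial.X) := by
  induction d generalizing p with
  | zero =>
    rw [eq_C_of_natDegree_le_zero hp]
    exact ⟨p.coeff 0, Fin.elim0, Fin.elim0, by simp⟩
  | succ d ih =>
    obtain ⟨a₀, b₀, q, hq, rfl⟩ : ∃ (a₀ b₀ : k) (q : k[X]), q.natDegree ≤ d ∧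
        p = (Polynomial.C a₀ + Polynomial.C b₀ * Polynomial.X) * q := by
      by_cases h : p.natDegree ≤ d
      · exact ⟨1, 0, p, h, by simp⟩
      · obtain ⟨r, hr⟩ := IsAlgClosed.exists_root p
          (fun h0 => h (by rw [natDegree_eq_of_degree_eq_some h0]; exact Nat.zero_le _))
        obtain ⟨q, rfl⟩ := dvd_iff_isRoot.mpr hr
        refine ⟨-r, 1, q, ?_, by simp [sub_eq_neg_add]⟩
        have hq0 : q ≠ 0 := by rintro rfl; simp at h
        rw [natDegree_mul (X_sub_C_ne_zero r) hq0, natDegree_X_sub_C] at hp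
        omega
    obtain ⟨c, a, b, rfl⟩ := ih q hq
    refine ⟨c, Fin.cons a₀ a, Fin.cons b₀ b, ?_⟩
    rw [Fin.prod_univ_succ]
    simp only [Fin.cons_zero, Fin.cons_succ]
    ring

/-- Over an algebraically closed field, a binary form is a product of linear forms. -/
lemma exists_eq_prod_linear_forms [IsAlgClosed k] {F : MvPolynomial (Fin 2) k} {d : ℕ}
    (hF : F.IsHomogeneous d) :
    ∃ (c : k) (a b : Fin d → k), F = C c * ∏ i, (C (a i) * X 0 + C (b i) * X 1) := by
  obtain ⟨c, a, b, h⟩ := exists_prod_linear d (dehom F) (natDegree_dehom_le hF)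
  refine ⟨c, a, b, eq_of_dehom_eq hF ?_ ?_⟩
  · have := IsHomogeneous.prod Finset.univ (fun i => C (a i) * X 0 + C (b i) * X 1) (fun _ => 1)
      fun i _ => ((isHomogeneous_X k (0 : Fin 2)).C_mul (a i)).add
        ((isHomogeneous_X k (1 : Fin 2)).C_mul (b i))
    simpa using this.C_mul c
  · rw [h, map_mul, map_prod]
    simp [dehom]

/-- The resultant of a composition with products of linear forms. -/
lemma bres_comp2_prod {f g : MvPolynomial (Fin 2) k} {d e : ℕ} (hf : f.IsHomogeneous e)
    (hg : g.IsHomogeneous e) (c c' : k) (a b a' b' : Fin d → k) :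
    bres (e * d) (comp2 (C c * ∏ i, (C (a i) * X 0 + C (b i) * X 1)) f g)
      (comp2 (C c' * ∏ i, (C (a' i) * X 0 + C (b' i) * X 1)) f g) =
    ((c * c') ^ d * ∏ j, ∏ i, (a i * b' j - b i * a' j)) ^ e * bres e f g ^ (d * d) := by
  have hhom : ∀ (c : k) (a b : Fin d → k),
      (C c * ∏ i, (C (a i) * X 0 + C (b i) * X 1) : MvPolynomial (Fin 2) k).IsHomogeneous d := by
    intro c a b
    have := IsHomogeneous.prod Finset.univ (fun i => C (a i) * X 0 + C (b i) * X 1) (fun _ => 1)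
      fun i _ => ((isHomogeneous_X k (0 : Fin 2)).C_mul (a i)).add
        ((isHomogeneous_X k (1 : Fin 2)).C_mul (b i))
    simpa using this.C_mul c
  have hde : ∀ (c : k) (a b : Fin d → k),
      dehom (comp2 (C c * ∏ i, (C (a i) * X 0 + C (b i) * X 1)) f g) =
        Polynomial.C c * ∏ i, (Polynomial.C (a i) * dehom f + Polynomial.C (b i) * dehom g) := by
    intro c a b
    simp only [comp2, map_mul, map_prod, map_add, aeval_C, aeval_X, algebraMap_eq]
    simp [dehom]
  rw [bres_eq_resultant (isHomogeneous_comp2 (hhom c a b) hf hg)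
    (isHomogeneous_comp2 (hhom c' a' b') hf hg), hde, hde, bres_eq_resultant hf hg,
    Polynomial.resultant_C_mul_left, Polynomial.resultant_C_mul_right]
  have hf' := natDegree_dehom_le hf
  have hg' := natDegree_dehom_le hg
  have hdeg : ∀ a b : k, (Polynomial.C a * dehom f + Polynomial.C b * dehom g).natDegree ≤ e :=
    fun a b => (Polynomial.natDegree_add_le _ _).trans
      (max_le ((Polynomial.natDegree_C_mul_le _ _).trans hf')
        ((Polynomial.natDegree_C_mul_le _ _).trans hg'))
  have := resultant_prod_prod Finset.univ Finset.univ
    (fun j : Fin d => Polynomial.C (a' j) * dehom f + Polynomial.C (b' j) * dehom g)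
    (fun i : Fin d => Polynomial.C (a i) * dehom f + Polynomial.C (b i) * dehom g)
    (fun i _ => hdeg _ _) (fun i _ => hdeg _ _)
  simp only [Finset.card_univ, Fintype.card_fin] at this
  rw [this]
  have hlin : ∀ i j : Fin d, (Polynomial.C (a' j) * dehom f + Polynomial.C (b' j) * dehom g).resultant
      (Polynomial.C (a i) * dehom f + Polynomial.C (b i) * dehom g) e e =
      (a i * b' j - b i * a' j) ^ e * (dehom g).resultant (dehom f) e e := by
    intro i j
    rw [add_comm, add_comm (Polynomial.C (a i) * _), resultant_linear_comb hg' hf']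
    ring
  simp only [hlin, Finset.prod_mul_distrib, Finset.prod_const, Finset.card_univ, Fintype.card_fin,
    Finset.prod_pow]
  ring

lemma bres_X_X : bres 1 (X 0 : MvPolynomial (Fin 2) k) (X 1) = 1 := by
  rw [bres_eq_resultant (isHomogeneous_X _ _) (isHomogeneous_X _ _)]
  have h0 : dehom (X 0 : MvPolynomial (Fin 2) k) = 1 := aeval_X _ _
  have h1 : dehom (X 1 : MvPolynomial (Fin 2) k) = Polynomial.X ^ 1 :=
    (aeval_X _ _).trans (pow_one _).symm
  rw [h0, h1, Polynomial.resultant_X_pow_left _ _ _ (by simp)]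
  simp

/-- The resultant of a composition of pairs of binary forms. -/
lemma bres_comp2 [IsAlgClosed k] {F G f g : MvPolynomial (Fin 2) k} {d e : ℕ}
    (hF : F.IsHomogeneous d) (hG : G.IsHomogeneous d) (hf : f.IsHomogeneous e)
    (hg : g.IsHomogeneous e) :
    bres (e * d) (comp2 F f g) (comp2 G f g) = bres d F G ^ e * bres e f g ^ (d * d) := by
  obtain ⟨c, a, b, hF'⟩ := exists_eq_prod_linear_forms hF
  obtain ⟨c', a', b', hG'⟩ := exists_eq_prod_linear_forms hG
  have h1 := bres_comp2_prod hf hg c c' a b a' b'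
  have h2 := bres_comp2_prod (isHomogeneous_X k (0 : Fin 2)) (isHomogeneous_X k (1 : Fin 2))
    c c' a b a' b'
  rw [← hF', ← hG'] at h1 h2
  rw [h1]
  congr 2
  rw [bres_X_X, one_pow, mul_one, pow_one, one_mul] at h2
  rw [← h2]
  have hid : ![X 0, X 1] = (X : Fin 2 → MvPolynomial (Fin 2) k) := by
    ext1 i
    fin_cases i <;> rfl
  simp [comp2, hid]

lemma bres_ne_zero_of_isRelPrime [IsAlgClosed k] {F G : MvPolynomial (Fin 2) k} {d : ℕ}
    (hd : d ≠ 0) (hF : F.IsHomogeneous d) (hG : G.IsHomogeneous d) (h : IsRelPrime F G) :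
    bres d F G ≠ 0 := by
  obtain ⟨c, a, b, hF'⟩ := exists_eq_prod_linear_forms hF
  obtain ⟨c', a', b', hG'⟩ := exists_eq_prod_linear_forms hG
  have h2 := bres_comp2_prod (isHomogeneous_X k (0 : Fin 2)) (isHomogeneous_X k (1 : Fin 2))
    c c' a b a' b'
  rw [← hF', ← hG', bres_X_X, one_pow, mul_one, pow_one, one_mul] at h2
  have hid : ![X 0, X 1] = (X : Fin 2 → MvPolynomial (Fin 2) k) := by
    ext1 i
    fin_cases i <;> rfl
  have h3 : bres d F G = (c * c') ^ d * ∏ j, ∏ i, (a i * b' j - b i * a' j) := by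
    rw [← h2]
    simp [comp2, hid]
  have hunit : ∀ H : MvPolynomial (Fin 2) k, H.IsHomogeneous d → ¬IsUnit H := by
    intro H hH hu
    have h0 := hu.map (eval ![(0 : k), 0])
    have : eval ![(0 : k), 0] H = 0 := by
      have := aeval_mul_of_isHomogeneous hH (0 : k) 0 0
      simpa [hd, MvPolynomial.aeval_eq_eval] using this
    rw [this] at h0
    exact not_isUnit_zero h0
  have hF0 : F ≠ 0 := by
    rintro rfl
    exact hunit G hG (isRelPrime_zero_left.mp h)
  have hG0 : G ≠ 0 := by
    rintro rfl
    exact hunit F hF (isRelPrime_zero_right.mp h)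
  rw [hF'] at hF0
  rw [hG'] at hG0
  obtain ⟨hc, hp⟩ := mul_ne_zero_iff.mp hF0
  obtain ⟨hc', hp'⟩ := mul_ne_zero_iff.mp hG0
  rw [Finset.prod_ne_zero_iff] at hp hp'
  rw [h3]
  refine mul_ne_zero (pow_ne_zero _ (mul_ne_zero (by simpa using hc) (by simpa using hc'))) ?_
  refine Finset.prod_ne_zero_iff.mpr fun j _ => Finset.prod_ne_zero_iff.mpr fun i _ h0 => ?_
  have hi : C (a i) * X 0 + C (b i) * X 1 ∣ F := by
    rw [hF']
    exact (Finset.dvd_prod_of_mem (fun i => C (a i) * X 0 + C (b i) * X 1)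
      (Finset.mem_univ i)).mul_left _
  have hj : C (a i) * X 0 + C (b i) * X 1 ∣ G := by
    rw [hG']
    refine Dvd.dvd.mul_left (dvd_trans ?_ (Finset.dvd_prod_of_mem
      (fun i => C (a' i) * X 0 + C (b' i) * X 1) (Finset.mem_univ j))) _
    by_cases ha : a i = 0
    · have hb : b i ≠ 0 := fun hb => hp i (Finset.mem_univ i) (by simp [ha, hb])
      have ha' : a' j = 0 := by simpa [ha, hb] using h0
      refine ⟨C (b' j / b i), ?_⟩
      rw [ha, ha', C_0, zero_mul, zero_add, zero_add, mul_right_comm, ← C_mul,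
        mul_div_cancel₀ _ hb]
    · refine ⟨C (a' j / a i), ?_⟩
      rw [add_mul, mul_right_comm, ← C_mul, mul_div_cancel₀ _ ha, mul_right_comm, ← C_mul,
        show b i * (a' j / a i) = b' j by field_simp; linear_combination -h0]
  have hu := (h hi hj).map (eval ![(0 : k), 0])
  simp at hu

end Resultant

section Transfer

variable {k : Type*} [inst : CommRing k]

lemma IsField.unstable_pairIter (hk : IsField k) {F G : MvPolynomial (Fin 2) k} {d : ℕ}
    (hF : F.IsHomogeneous d) (hG : G.IsHomogeneous d) (h : Unstable d F G) {n : ℕ} (hn : 1 ≤ n) :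
    Unstable (d ^ n) (pairIter F G n).1 (pairIter F G n).2 := by
  obtain ⟨f, rfl⟩ : ∃ f : Field k, f.toCommRing = inst := ⟨hk.toField, rfl⟩
  exact h.pairIter hF hG hn

lemma IsField.exists_semistable_decomposition (hk : IsField k) {F G : MvPolynomial (Fin 2) k}
    {d : ℕ} (hF : F.IsHomogeneous d) (hG : G.IsHomogeneous d) (h : ¬Unstable d F G) :
    ∃ (A F0 G0 : MvPolynomial (Fin 2) k) (e : ℕ), e ≤ d ∧ A.IsHomogeneous (d - e) ∧
      F0.IsHomogeneous e ∧ G0.IsHomogeneous e ∧ F = A * F0 ∧ G = A * G0 ∧ IsRelPrime F0 G0 ∧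
      ∀ (a b : k), ¬(a = 0 ∧ b = 0) → ∀ r : ℕ, (C b * X 0 - C a * X 1) ^ r ∣ A →
        2 * r ≤ d + 1 ∧ (d ≤ 2 * r → b * eval ![a, b] F0 ≠ a * eval ![a, b] G0) := by
  obtain ⟨f, rfl⟩ : ∃ f : Field k, f.toCommRing = inst := ⟨hk.toField, rfl⟩
  exact _root_.exists_semistable_decomposition hF hG h

lemma IsField.not_unstable_of_decomposition (hk : IsField k) {A F0 G0 : MvPolynomial (Fin 2) k}
    {d : ℕ} (hrel : IsRelPrime F0 G0)
    (h : ∀ (a b : k), ¬(a = 0 ∧ b = 0) → ∀ r : ℕ, (C b * X 0 - C a * X 1) ^ r ∣ A →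
        2 * r ≤ d + 1 ∧ (d ≤ 2 * r → b * eval ![a, b] F0 ≠ a * eval ![a, b] G0)) :
    ¬Unstable d (A * F0) (A * G0) := by
  obtain ⟨f, rfl⟩ : ∃ f : Field k, f.toCommRing = inst := ⟨hk.toField, rfl⟩
  exact _root_.not_unstable_of_decomposition hrel h

lemma Unstable.C_mul {F G : MvPolynomial (Fin 2) k} {d : ℕ} (h : Unstable d F G) (u : k) :
    Unstable d (C u * F) (C u * G) := by
  obtain ⟨a, b, r, hab, h0, h1, h2, h3⟩ := h
  refine ⟨a, b, r, hab, h0, h1.mul_left _, h2.mul_left _, ?_⟩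
  rw [mul_left_comm, mul_left_comm (C a), ← mul_sub]
  exact h3.mul_left _

end Transfer

section Reduction

/-- The reduction homomorphism from the ring of integers to the residue field. -/
def resHom : intRing K →+* kk K := Ideal.Quotient.mk (maxIdl K)

variable {K}

lemma redCoeff_coe (x : intRing K) : redCoeff K x = resHom K x := dif_pos x.2

lemma redCoeff_eq_zero {x : K} (hx : ‖x‖ < 1) : redCoeff K x = 0 := by
  refine (redCoeff_coe ⟨x, hx.le⟩).trans ?_
  exact Ideal.Quotient.eq_zero_iff_mem.mpr hx

lemma kk_isField : IsField (kk K) := by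
  refine ⟨⟨0, resHom K 1, fun h => ?_⟩, mul_comm, fun {x} hx => ?_⟩
  · have h1 : (1 : intRing K) ∈ maxIdl K := Ideal.Quotient.eq_zero_iff_mem.mp h.symm
    have h2 : ‖((1 : intRing K) : K)‖ < 1 := h1
    simp at h2
  · obtain ⟨x, rfl⟩ := Ideal.Quotient.mk_surjective x
    have h1 : ¬‖(x : K)‖ < 1 := fun h => hx (Ideal.Quotient.eq_zero_iff_mem.mpr h)
    have h2 : ‖(x : K)‖ = 1 := le_antisymm x.2 (not_lt.mp h1)
    have h3 : (x : K) ≠ 0 := norm_ne_zero_iff.mp (by simp [h2])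
    refine ⟨resHom K ⟨(x : K)⁻¹, by simp [intRing, h2]⟩, ?_⟩
    refine ((resHom K).map_mul x _).symm.trans (Eq.trans (congrArg (resHom K) ?_) (map_one _))
    exact Subtype.ext (mul_inv_cancel₀ h3)

lemma coeff_redPoly (F : MvPolynomial (Fin 2) K) (m : Fin 2 →₀ ℕ) :
    (redPoly K F).coeff m = redCoeff K (F.coeff m) := by
  rw [redPoly, coeff_sum]
  simp only [coeff_monomial, Finset.sum_ite_eq']
  split_ifs with h
  · rfl
  · rw [notMem_support_iff.mp h, redCoeff_eq_zero (by simp)]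

lemma redPoly_map (P : MvPolynomial (Fin 2) (intRing K)) :
    redPoly K (map (intRing K).subtype P) = map (resHom K) P := by
  ext m
  rw [coeff_redPoly, coeff_map, coeff_map]
  exact redCoeff_coe _

lemma norm_coeff_map_le (P : MvPolynomial (Fin 2) (intRing K)) (m : Fin 2 →₀ ℕ) :
    ‖(map (intRing K).subtype P).coeff m‖ ≤ 1 := by
  rw [coeff_map]
  exact (P.coeff m).2

lemma exists_map_subtype_eq {F : MvPolynomial (Fin 2) K} (hF : ∀ m, ‖F.coeff m‖ ≤ 1) :
    ∃ P, map (intRing K).subtype P = F := by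
  refine ⟨∑ m ∈ F.support, monomial m ⟨F.coeff m, hF m⟩, ?_⟩
  conv_rhs => rw [F.as_sum]
  simp [map_sum, map_monomial]

lemma IsHomogeneous.of_map_subtype {P : MvPolynomial (Fin 2) (intRing K)} {d : ℕ}
    (h : (map (intRing K).subtype P).IsHomogeneous d) : P.IsHomogeneous d :=
  IsHomogeneous.of_map (Subtype.val_injective) h

lemma redPoly_smul {c : K} (hc : ‖c‖ ≤ 1) {F : MvPolynomial (Fin 2) K}
    (hF : ∀ m, ‖F.coeff m‖ ≤ 1) : redPoly K (c • F) = C (redCoeff K c) * redPoly K F := by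
  obtain ⟨P, rfl⟩ := exists_map_subtype_eq hF
  have h : c • map (intRing K).subtype P = map (intRing K).subtype (C ⟨c, hc⟩ * P) := by
    rw [map_mul, map_C, smul_eq_C_mul]
    rfl
  rw [h, redPoly_map, redPoly_map, map_mul, map_C, ← redCoeff_coe]

lemma isHomogeneous_redPoly {F : MvPolynomial (Fin 2) K} {d : ℕ} (hF : F.IsHomogeneous d) :
    (redPoly K F).IsHomogeneous d := by
  intro m hm
  refine hF fun h => hm ?_
  rw [coeff_redPoly, h, redCoeff_eq_zero (by simp)]

lemma norm_coeff_pairIter_le {F G : MvPolynomial (Fin 2) K} (hF : ∀ m, ‖F.coeff m‖ ≤ 1)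
    (hG : ∀ m, ‖G.coeff m‖ ≤ 1) (n : ℕ) :
    (∀ m, ‖(pairIter F G n).1.coeff m‖ ≤ 1) ∧ ∀ m, ‖(pairIter F G n).2.coeff m‖ ≤ 1 := by
  obtain ⟨P, rfl⟩ := exists_map_subtype_eq hF
  obtain ⟨Q, rfl⟩ := exists_map_subtype_eq hG
  obtain ⟨h1, h2⟩ := map_pairIter (intRing K).subtype P Q n
  rw [← h1, ← h2]
  exact ⟨norm_coeff_map_le _, norm_coeff_map_le _⟩

lemma redPoly_pairIter {F G : MvPolynomial (Fin 2) K} (hF : ∀ m, ‖F.coeff m‖ ≤ 1)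
    (hG : ∀ m, ‖G.coeff m‖ ≤ 1) (n : ℕ) :
    redPoly K (pairIter F G n).1 = (pairIter (redPoly K F) (redPoly K G) n).1 ∧
      redPoly K (pairIter F G n).2 = (pairIter (redPoly K F) (redPoly K G) n).2 := by
  obtain ⟨P, rfl⟩ := exists_map_subtype_eq hF
  obtain ⟨Q, rfl⟩ := exists_map_subtype_eq hG
  obtain ⟨h1, h2⟩ := map_pairIter (intRing K).subtype P Q n
  obtain ⟨h3, h4⟩ := map_pairIter (resHom K) P Q n
  rw [← h1, ← h2, redPoly_map, redPoly_map, redPoly_map, redPoly_map, h3, h4]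
  exact ⟨rfl, rfl⟩

lemma ordv_mul {x y : K} (hx : x ≠ 0) (hy : y ≠ 0) : ordv K (x * y) = ordv K x + ordv K y := by
  rw [ordv, ordv, ordv, norm_mul, Real.log_mul (norm_ne_zero_iff.mpr hx) (norm_ne_zero_iff.mpr hy)]
  ring

lemma ordv_pow (x : K) (n : ℕ) : ordv K (x ^ n) = n * ordv K x := by
  rw [ordv, ordv, norm_pow, Real.log_pow]
  ring

lemma ordv_bres_pairIter [IsAlgClosed K] {F G : MvPolynomial (Fin 2) K} {d : ℕ} (hd : 2 ≤ d)
    (hF : F.IsHomogeneous d) (hG : G.IsHomogeneous d) (h : bres d F G ≠ 0) (n : ℕ) :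
    bres (d ^ n) (pairIter F G n).1 (pairIter F G n).2 ≠ 0 ∧
      ordv K (bres (d ^ n) (pairIter F G n).1 (pairIter F G n).2) =
        ((d : ℝ) ^ n * ((d : ℝ) ^ n - 1) / ((d : ℝ) * ((d : ℝ) - 1))) * ordv K (bres d F G) := by
  induction n with
  | zero => simp [pairIter, bres_X_X, ordv]
  | succ n ih =>
    obtain ⟨h0, ih⟩ := ih
    obtain ⟨h1, h2⟩ := isHomogeneous_pairIter hF hG n
    have h3 := bres_comp2 hF hG h1 h2
    rw [← pow_succ] at h3
    change bres (d ^ (n + 1)) (comp2 F _ _) (comp2 G _ _) ≠ 0 ∧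
      ordv K (bres (d ^ (n + 1)) (comp2 F _ _) (comp2 G _ _)) = _
    rw [h3]
    refine ⟨mul_ne_zero (pow_ne_zero _ h) (pow_ne_zero _ h0), ?_⟩
    rw [ordv_mul (pow_ne_zero _ h) (pow_ne_zero _ h0), ordv_pow, ordv_pow, ih]
    have hd1 : (2 : ℝ) ≤ d := by exact_mod_cast hd
    have hd2 : (d : ℝ) - 1 ≠ 0 := by linarith
    have hd3 : (d : ℝ) ≠ 0 := by linarith
    push_cast
    field_simp
    ring

lemma norm_coeff_le_maxNorm {F G : MvPolynomial (Fin 2) K} {e : ℕ} (hF : F.IsHomogeneous e)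
    (hG : G.IsHomogeneous e) (m : Fin 2 →₀ ℕ) :
    ‖F.coeff m‖ ≤ maxNorm K e F G ∧ ‖G.coeff m‖ ≤ maxNorm K e F G := by
  have hle : ∀ i : Fin (e + 1),
      max ‖coeffVec e F i‖ ‖coeffVec e G i‖ ≤ maxNorm K e F G := fun i =>
    Finset.le_sup' (fun i : Fin (e + 1) => max ‖coeffVec e F i‖ ‖coeffVec e G i‖)
      (Finset.mem_univ i)
  by_cases hm : m 0 + m 1 = e
  · have key : m = Finsupp.single 0 (e - m 1) + Finsupp.single 1 (m 1) := by
      ext j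
      fin_cases j
      · simp; omega
      · simp
    have h1 := max_le_iff.mp (hle ⟨m 1, by omega⟩)
    rw [key]
    exact h1
  · have aux : ∀ H : MvPolynomial (Fin 2) K, H.IsHomogeneous e → H.coeff m = 0 := fun H hH => by
      by_contra h0
      exact hm (isHomogeneous_exponent_sum hH h0)
    have h0 : 0 ≤ maxNorm K e F G :=
      (norm_nonneg _).trans ((le_max_left _ _).trans (hle 0))
    rw [aux F hF, aux G hG, norm_zero]
    exact ⟨h0, h0⟩

lemma maxNorm_le {F G : MvPolynomial (Fin 2) K} (e : ℕ) {c : ℝ} (hF : ∀ m, ‖F.coeff m‖ ≤ c)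
    (hG : ∀ m, ‖G.coeff m‖ ≤ c) : maxNorm K e F G ≤ c :=
  Finset.sup'_le _ _ fun _ _ => max_le (hF _) (hG _)

lemma Normalized.maxNorm_eq_one {F G : MvPolynomial (Fin 2) K} {e : ℕ} (hF : F.IsHomogeneous e)
    (hG : G.IsHomogeneous e) (h : Normalized K F G) : maxNorm K e F G = 1 := by
  obtain ⟨h1, h2, m, hm⟩ := h
  refine le_antisymm (maxNorm_le e h1 h2) ?_
  have := norm_coeff_le_maxNorm hF hG m
  rcases hm with hm | hm <;> rw [hm] at this
  · exact this.1
  · exact this.2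

end Reduction

section Action

variable {S : Type*} [CommRing S]

/-- Linear substitution of a `2×2` matrix into a binary form. -/
def linSubst (A : Matrix (Fin 2) (Fin 2) S) (F : MvPolynomial (Fin 2) S) :
    MvPolynomial (Fin 2) S :=
  comp2 F (C (A 0 0) * X 0 + C (A 0 1) * X 1) (C (A 1 0) * X 0 + C (A 1 1) * X 1)

/-- The pair `B ∘ (F, G) ∘ A` for a pair `P = (F, G)` of binary forms. -/
def act (B A : Matrix (Fin 2) (Fin 2) S) (P : MvPolynomial (Fin 2) S × MvPolynomial (Fin 2) S) :
    MvPolynomial (Fin 2) S × MvPolynomial (Fin 2) S :=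
  (C (B 0 0) * linSubst A P.1 + C (B 0 1) * linSubst A P.2,
    C (B 1 0) * linSubst A P.1 + C (B 1 1) * linSubst A P.2)

lemma isHomogeneous_linear (a b : S) :
    (C a * X 0 + C b * X 1 : MvPolynomial (Fin 2) S).IsHomogeneous 1 :=
  ((isHomogeneous_X _ _).C_mul _).add ((isHomogeneous_X _ _).C_mul _)

lemma isHomogeneous_linSubst (A : Matrix (Fin 2) (Fin 2) S) {F : MvPolynomial (Fin 2) S} {e : ℕ}
    (hF : F.IsHomogeneous e) : (linSubst A F).IsHomogeneous e := by
  rw [← one_mul e]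
  exact isHomogeneous_comp2 hF (isHomogeneous_linear _ _) (isHomogeneous_linear _ _)

lemma isHomogeneous_act (B A : Matrix (Fin 2) (Fin 2) S)
    {P : MvPolynomial (Fin 2) S × MvPolynomial (Fin 2) S} {e : ℕ} (h1 : P.1.IsHomogeneous e)
    (h2 : P.2.IsHomogeneous e) :
    (act B A P).1.IsHomogeneous e ∧ (act B A P).2.IsHomogeneous e :=
  ⟨((isHomogeneous_linSubst A h1).C_mul _).add ((isHomogeneous_linSubst A h2).C_mul _),
    ((isHomogeneous_linSubst A h1).C_mul _).add ((isHomogeneous_linSubst A h2).C_mul _)⟩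

lemma linSubst_add (A : Matrix (Fin 2) (Fin 2) S) (F G : MvPolynomial (Fin 2) S) :
    linSubst A (F + G) = linSubst A F + linSubst A G := map_add _ _ _

lemma linSubst_mul (A : Matrix (Fin 2) (Fin 2) S) (F G : MvPolynomial (Fin 2) S) :
    linSubst A (F * G) = linSubst A F * linSubst A G := map_mul _ _ _

lemma linSubst_C (A : Matrix (Fin 2) (Fin 2) S) (a : S) : linSubst A (C a) = C a := aeval_C _ _

lemma linSubst_X (A : Matrix (Fin 2) (Fin 2) S) (i : Fin 2) :
    linSubst A (X i) = C (A i 0) * X 0 + C (A i 1) * X 1 := by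
  fin_cases i <;> simp [linSubst, comp2]

lemma linSubst_one (F : MvPolynomial (Fin 2) S) : linSubst 1 F = F := by
  induction F using MvPolynomial.induction_on with
  | C a => exact linSubst_C _ _
  | add p q hp hq => rw [linSubst_add, hp, hq]
  | mul_X p i hp =>
    rw [linSubst_mul, hp]
    congr 1
    fin_cases i
    · simpa using linSubst_X (1 : Matrix (Fin 2) (Fin 2) S) 0
    · simpa using linSubst_X (1 : Matrix (Fin 2) (Fin 2) S) 1

lemma linSubst_linSubst (A B : Matrix (Fin 2) (Fin 2) S) (F : MvPolynomial (Fin 2) S) :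
    linSubst A (linSubst B F) = linSubst (B * A) F := by
  induction F using MvPolynomial.induction_on with
  | C a => simp only [linSubst_C]
  | add p q hp hq => simp only [linSubst_add, hp, hq]
  | mul_X p i hp =>
    simp only [linSubst_mul, hp, linSubst_X, linSubst_add, linSubst_C, Matrix.mul_apply,
      Fin.sum_univ_two, C_add, C_mul]
    ring

lemma act_one (P : MvPolynomial (Fin 2) S × MvPolynomial (Fin 2) S) : act 1 1 P = P := by
  simp [act, linSubst_one]

lemma act_act (B A B' A' : Matrix (Fin 2) (Fin 2) S)
    (P : MvPolynomial (Fin 2) S × MvPolynomial (Fin 2) S) :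
    act B A (act B' A' P) = act (B * B') (A' * A) P := by
  simp only [act, linSubst_add, linSubst_mul, linSubst_C, linSubst_linSubst, Matrix.mul_apply,
    Fin.sum_univ_two, C_add, C_mul]
  refine Prod.ext ?_ ?_ <;> simp only <;> ring

lemma map_linSubst {T : Type*} [CommRing T] (φ : S →+* T) (A : Matrix (Fin 2) (Fin 2) S)
    (F : MvPolynomial (Fin 2) S) : map φ (linSubst A F) = linSubst (A.map φ) (map φ F) := by
  simp [linSubst, map_comp2]

lemma map_act {T : Type*} [CommRing T] (φ : S →+* T) (B A : Matrix (Fin 2) (Fin 2) S)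
    (P : MvPolynomial (Fin 2) S × MvPolynomial (Fin 2) S) :
    act (B.map φ) (A.map φ) (map φ P.1, map φ P.2) =
      (map φ (act B A P).1, map φ (act B A P).2) := by
  simp [act, map_linSubst]

lemma map_mul_map_eq_one {T : Type*} [CommRing T] (φ : S →+* T) {A B : Matrix (Fin 2) (Fin 2) S}
    (h : A * B = 1) : A.map φ * B.map φ = 1 := by
  rw [← Matrix.map_mul, h]
  exact Matrix.map_one _ (map_zero _) (map_one _)

lemma coeff_linSubst_diagonal (δ μ : S) (F : MvPolynomial (Fin 2) S) (m : Fin 2 →₀ ℕ) :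
    (linSubst !![δ, 0; 0, μ] F).coeff m = δ ^ m 0 * μ ^ m 1 * F.coeff m := by
  induction F using MvPolynomial.induction_on' with
  | add p q hp hq => rw [linSubst_add, coeff_add, coeff_add, hp, hq, mul_add]
  | monomial u a =>
    have h : linSubst !![δ, 0; 0, μ] (monomial u a) = monomial u (δ ^ u 0 * μ ^ u 1 * a) := by
      rw [linSubst, comp2, aeval_monomial, Finsupp.prod_fintype _ _ (by simp), monomial_eq,
        Finsupp.prod_fintype _ _ (by simp)]
      simp [mul_pow]
      ring
    rw [h, coeff_monomial, coeff_monomial]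
    split_ifs with h
    · rw [h]
    · rw [mul_zero]

/-- A pair is unstable if it is obtained by a change of coordinates from a pair vanishing to high
order at the point `X = 0`. -/
lemma unstable_act [Nontrivial S] {U U' : Matrix (Fin 2) (Fin 2) S} (h : U * U' = 1)
    {P : MvPolynomial (Fin 2) S × MvPolynomial (Fin 2) S} {e r : ℕ} (her : e ≤ 2 * r)
    (h1 : X 0 ^ (r + 1) ∣ P.1) (h2 : X 0 ^ r ∣ P.2) :
    Unstable e (act U U' P).1 (act U U' P).2 := by
  have e00 := congrFun (congrFun h 0) 0
  have e01 := congrFun (congrFun h 0) 1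
  have e10 := congrFun (congrFun h 1) 0
  have e11 := congrFun (congrFun h 1) 1
  simp only [Matrix.mul_apply, Fin.sum_univ_two, Matrix.one_apply_eq, ne_eq, zero_ne_one,
    one_ne_zero, not_false_eq_true, Matrix.one_apply_ne] at e00 e01 e10 e11
  have hX : linSubst U' (X 0) = C U'.det * pointForm (U 0 1) (U 1 1) := by
    have ha : U' 0 0 = U'.det * U 1 1 := by
      rw [Matrix.det_fin_two]
      linear_combination (-U' 0 0) * e11 + U' 0 1 * e10
    have hb : U' 0 1 = -(U'.det * U 0 1) := by
      rw [Matrix.det_fin_two]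
      linear_combination (U' 0 0) * e01 - U' 0 1 * e00
    rw [linSubst_X, ha, hb, pointForm]
    simp only [C_neg, C_mul]
    ring
  have hdvd : ∀ (s : ℕ) (Q : MvPolynomial (Fin 2) S), X 0 ^ s ∣ Q →
      pointForm (U 0 1) (U 1 1) ^ s ∣ linSubst U' Q := by
    rintro s _ ⟨Q, rfl⟩
    have hpow : linSubst U' (X 0 ^ s) = linSubst U' (X 0) ^ s := map_pow _ _ _
    rw [linSubst_mul, hpow, hX, mul_pow]
    exact (Dvd.intro_left _ rfl).mul_right _
  have h1' := hdvd _ _ h1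
  have h1'' := (pow_dvd_pow (pointForm (U 0 1) (U 1 1)) (Nat.le_succ r)).trans h1'
  have h2' := hdvd _ _ h2
  refine ⟨U 0 1, U 1 1, r, ?_, her, ?_, ?_, ?_⟩
  · rintro ⟨hb, hd⟩
    rw [hb] at e00 e01
    rw [hd] at e11
    have : (1 : S) = 0 := by
      linear_combination (-U 1 0 * U' 0 1) * e00 + (U 1 0 * U' 0 0) * e01 - e11
    exact one_ne_zero this
  · exact dvd_add (h1''.mul_left _) (h2'.mul_left _)
  · exact dvd_add (h1''.mul_left _) (h2'.mul_left _)
  · have : C (U 1 1) * (act U U' P).1 - C (U 0 1) * (act U U' P).2 =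
        (C (U 1 1) * C (U 0 0) - C (U 0 1) * C (U 1 0)) * linSubst U' P.1 := by
      simp only [act]
      ring
    rw [this]
    exact h1'.mul_left _

lemma X_pow_dvd_of_coeff {F : MvPolynomial (Fin 2) S} {r : ℕ}
    (h : ∀ m : Fin 2 →₀ ℕ, m 0 < r → F.coeff m = 0) : X 0 ^ r ∣ F := by
  rw [F.as_sum]
  refine Finset.dvd_sum fun m hm => ?_
  rw [X_pow_eq_monomial, monomial_dvd_monomial]
  refine ⟨Or.inr ?_, one_dvd _⟩
  rw [Finsupp.single_le_iff]
  exact not_lt.mp fun hlt => mem_support_iff.mp hm (h m hlt)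

end Action

section Resultant

variable {k : Type*} [Field k]

lemma bres_linear (A : Matrix (Fin 2) (Fin 2) k) :
    bres 1 (C (A 0 0) * X 0 + C (A 0 1) * X 1) (C (A 1 0) * X 0 + C (A 1 1) * X 1) = A.det := by
  have h := bres_comp2_prod (isHomogeneous_X k (0 : Fin 2)) (isHomogeneous_X k (1 : Fin 2)) 1 1
    (fun _ : Fin 1 => A 0 0) (fun _ => A 0 1) (fun _ => A 1 0) (fun _ => A 1 1)
  simpa [bres_X_X, comp2, Matrix.det_fin_two] using h

lemma bres_act [IsAlgClosed k] (B A : Matrix (Fin 2) (Fin 2) k)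
    {P : MvPolynomial (Fin 2) k × MvPolynomial (Fin 2) k} {e : ℕ} (h1 : P.1.IsHomogeneous e)
    (h2 : P.2.IsHomogeneous e) :
    bres e (act B A P).1 (act B A P).2 = B.det ^ e * (bres e P.1 P.2 * A.det ^ (e * e)) := by
  have e1 := bres_comp2 (isHomogeneous_linear (B 0 0) (B 0 1)) (isHomogeneous_linear (B 1 0) (B 1 1))
    (isHomogeneous_linSubst A h1) (isHomogeneous_linSubst A h2)
  have e2 := bres_comp2 h1 h2 (isHomogeneous_linear (A 0 0) (A 0 1))
    (isHomogeneous_linear (A 1 0) (A 1 1))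
  rw [bres_linear] at e1 e2
  rw [pow_one, one_mul] at e2
  rw [one_mul, pow_one, mul_one] at e1
  rw [← e2]
  refine Eq.trans ?_ e1
  simp [act, comp2]

end Resultant

section Minimality

variable {K}

lemma norm_coeff_linSubst_le (A : Matrix (Fin 2) (Fin 2) (intRing K)) {F : MvPolynomial (Fin 2) K}
    {c : ℝ} (hF : ∀ m, ‖F.coeff m‖ ≤ c) (m : Fin 2 →₀ ℕ) :
    ‖(linSubst (A.map (intRing K).subtype) F).coeff m‖ ≤ c := by
  have hc : 0 ≤ c := (norm_nonneg _).trans (hF 0)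
  have h : linSubst (A.map (intRing K).subtype) F =
      ∑ u ∈ F.support, C (F.coeff u) * map (intRing K).subtype (linSubst A (monomial u 1)) := by
    conv_lhs => rw [F.as_sum]
    rw [linSubst, comp2, map_sum]
    refine Finset.sum_congr rfl fun u _ => ?_
    change linSubst _ _ = _
    rw [map_linSubst, map_monomial, map_one, ← linSubst_C (A.map (intRing K).subtype),
      ← linSubst_mul, C_mul_monomial, mul_one]
  rw [h, coeff_sum]
  refine IsUltrametricDist.norm_sum_le_of_forall_le_of_nonneg hc fun u _ => ?_
  rw [coeff_C_mul, norm_mul]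
  calc _ ≤ c * 1 := mul_le_mul (hF u) (norm_coeff_map_le _ _) (norm_nonneg _) hc
    _ = c := mul_one c

lemma norm_coeff_act_le (B A : Matrix (Fin 2) (Fin 2) (intRing K))
    {P : MvPolynomial (Fin 2) K × MvPolynomial (Fin 2) K} {c : ℝ} (h1 : ∀ m, ‖P.1.coeff m‖ ≤ c)
    (h2 : ∀ m, ‖P.2.coeff m‖ ≤ c) (m : Fin 2 →₀ ℕ) :
    ‖(act (B.map (intRing K).subtype) (A.map (intRing K).subtype) P).1.coeff m‖ ≤ c ∧
      ‖(act (B.map (intRing K).subtype) (A.map (intRing K).subtype) P).2.coeff m‖ ≤ c := by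
  have hc : 0 ≤ c := (norm_nonneg _).trans (h1 0)
  have aux : ∀ (x y : intRing K), ‖(C (x : K) * linSubst (A.map (intRing K).subtype) P.1 +
      C (y : K) * linSubst (A.map (intRing K).subtype) P.2).coeff m‖ ≤ c := by
    intro x y
    rw [coeff_add, coeff_C_mul, coeff_C_mul]
    refine (IsUltrametricDist.norm_add_le_max _ _).trans (max_le ?_ ?_)
    · rw [norm_mul, ← one_mul c]
      exact mul_le_mul x.2 (norm_coeff_linSubst_le A h1 m) (norm_nonneg _) zero_le_one
    · rw [norm_mul, ← one_mul c]
      exact mul_le_mul y.2 (norm_coeff_linSubst_le A h2 m) (norm_nonneg _) zero_le_one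
  exact ⟨aux _ _, aux _ _⟩

/-- Cartan decomposition of a `2×2` matrix. -/
lemma exists_cartan_decomposition (M : Matrix (Fin 2) (Fin 2) K) :
    ∃ U U' V V' : Matrix (Fin 2) (Fin 2) (intRing K), U * U' = 1 ∧ V * V' = 1 ∧
      ∃ δ μ : K, ‖δ‖ ≤ ‖μ‖ ∧
        M = U.map (intRing K).subtype * !![δ, 0; 0, μ] * V.map (intRing K).subtype := by
  have base : ∀ p q r s : K, ‖p‖ ≤ ‖s‖ → ‖q‖ ≤ ‖s‖ → ‖r‖ ≤ ‖s‖ →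
      ∃ U U' V V' : Matrix (Fin 2) (Fin 2) (intRing K), U * U' = 1 ∧ V * V' = 1 ∧
      ∃ δ μ : K, ‖δ‖ ≤ ‖μ‖ ∧
        !![p, q; r, s] = U.map (intRing K).subtype * !![δ, 0; 0, μ] *
          V.map (intRing K).subtype := by
    intro p q r s hp hq hr
    have hdiv_le : ∀ x : K, ‖x‖ ≤ ‖s‖ → ‖x / s‖ ≤ 1 := fun x hx => by
      rw [norm_div]
      exact div_le_one_of_le₀ hx (norm_nonneg _)
    have hdiv : ∀ x : K, ‖x‖ ≤ ‖s‖ → x / s * s = x := fun x hx =>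
      div_mul_cancel_of_imp fun hs => norm_le_zero_iff.mp (hx.trans (by simp [hs]))
    have hx := hdiv q hq
    have hy := hdiv r hr
    refine ⟨!![1, ⟨q / s, hdiv_le q hq⟩; 0, 1], !![1, -⟨q / s, hdiv_le q hq⟩; 0, 1],
      !![1, 0; ⟨r / s, hdiv_le r hr⟩, 1], !![1, 0; -⟨r / s, hdiv_le r hr⟩, 1], ?_, ?_,
      p - q / s * r, s, ?_, ?_⟩
    · simp [Matrix.one_fin_two]
    · simp [Matrix.one_fin_two]
    · rw [sub_eq_add_neg]
      refine (IsUltrametricDist.norm_add_le_max _ _).trans (max_le hp ?_)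
      rw [norm_neg, norm_mul, ← one_mul ‖s‖]
      exact mul_le_mul (hdiv_le q hq) hr (norm_nonneg _) zero_le_one
    · ext i j
      fin_cases i <;> fin_cases j <;> simp [Matrix.mul_apply, Fin.sum_univ_two, mul_comm s, hx, hy]
      ring
  have hsq : (!![0, 1; 1, 0] : Matrix (Fin 2) (Fin 2) (intRing K)) * !![0, 1; 1, 0] = 1 := by
    simp [Matrix.one_fin_two]
  have left : ∀ p q r s : K, ‖r‖ ≤ ‖q‖ → ‖p‖ ≤ ‖q‖ → ‖s‖ ≤ ‖q‖ →
      ∃ U U' V V' : Matrix (Fin 2) (Fin 2) (intRing K), U * U' = 1 ∧ V * V' = 1 ∧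
      ∃ δ μ : K, ‖δ‖ ≤ ‖μ‖ ∧
        !![p, q; r, s] = U.map (intRing K).subtype * !![δ, 0; 0, μ] *
          V.map (intRing K).subtype := by
    intro p q r s h1 h2 h3
    obtain ⟨U, U', V, V', hU, hV, δ, μ, hle, h⟩ := base r s p q h1 h3 h2
    refine ⟨!![0, 1; 1, 0] * U, U' * !![0, 1; 1, 0], V, V', ?_, hV, δ, μ, hle, ?_⟩
    · rw [Matrix.mul_assoc, ← Matrix.mul_assoc U, hU, Matrix.one_mul, hsq]
    · rw [Matrix.map_mul, Matrix.mul_assoc, Matrix.mul_assoc, ← Matrix.mul_assoc (U.map _), ← h]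
      ext i j
      fin_cases i <;> fin_cases j <;> simp [Matrix.mul_apply, Fin.sum_univ_two]
  have right : ∀ p q r s : K, (∃ U U' V V' : Matrix (Fin 2) (Fin 2) (intRing K),
      U * U' = 1 ∧ V * V' = 1 ∧ ∃ δ μ : K, ‖δ‖ ≤ ‖μ‖ ∧
        !![p, q; r, s] = U.map (intRing K).subtype * !![δ, 0; 0, μ] *
          V.map (intRing K).subtype) →
      ∃ U U' V V' : Matrix (Fin 2) (Fin 2) (intRing K), U * U' = 1 ∧ V * V' = 1 ∧
      ∃ δ μ : K, ‖δ‖ ≤ ‖μ‖ ∧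
        !![q, p; s, r] = U.map (intRing K).subtype * !![δ, 0; 0, μ] *
          V.map (intRing K).subtype := by
    rintro p q r s ⟨U, U', V, V', hU, hV, δ, μ, hle, h⟩
    refine ⟨U, U', V * !![0, 1; 1, 0], !![0, 1; 1, 0] * V', hU, ?_, δ, μ, hle, ?_⟩
    · rw [Matrix.mul_assoc, ← Matrix.mul_assoc !![0, 1; 1, 0], hsq, Matrix.one_mul, hV]
    · rw [Matrix.map_mul, ← Matrix.mul_assoc, ← h]
      ext i j
      fin_cases i <;> fin_cases j <;> simp [Matrix.mul_apply, Fin.sum_univ_two]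
  have hmax : ∀ a b : K, ‖a‖ ≤ ‖b‖ ∨ ‖b‖ ≤ ‖a‖ := fun a b => le_total _ _
  rw [Matrix.eta_fin_two M]
  generalize M 0 0 = p
  generalize M 0 1 = q
  generalize M 1 0 = r
  generalize M 1 1 = s
  rcases hmax p q with h1 | h1 <;> rcases hmax r s with h2 | h2
  · rcases hmax q s with h3 | h3
    · exact base p q r s (h1.trans h3) h3 h2
    · exact left p q r s (h2.trans h3) h1 h3
  · rcases hmax q r with h3 | h3
    · exact right q p s r (base q p s r h3 (h1.trans h3) h2)
    · exact left p q r s h3 h1 (h2.trans h3)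
  · rcases hmax p s with h3 | h3
    · exact base p q r s h3 (h1.trans h3) h2
    · exact right q p s r (left q p s r h3 h1 (h2.trans h3))
  · rcases hmax p r with h3 | h3
    · exact right q p s r (base q p s r (h1.trans h3) h3 h2)
    · exact right q p s r (left q p s r (h2.trans h3) h1 h3)

lemma norm_det_eq_one {U U' : Matrix (Fin 2) (Fin 2) (intRing K)} (h : U * U' = 1) :
    ‖(U.map (intRing K).subtype).det‖ = 1 := by
  have hdet : ((U.det : intRing K) : K) * (U'.det : intRing K) = 1 := by
    have := congrArg Matrix.det h
    rw [Matrix.det_mul, Matrix.det_one] at this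
    exact congrArg Subtype.val this
  have h1 : ‖((U.det : intRing K) : K)‖ ≤ 1 := U.det.2
  have h2 : ‖((U'.det : intRing K) : K)‖ ≤ 1 := U'.det.2
  have h3 := congrArg norm hdet
  rw [norm_mul, norm_one] at h3
  have h4 : (U.map (intRing K).subtype).det = ((U.det : intRing K) : K) :=
    ((intRing K).subtype.map_det U).symm
  rw [h4]
  nlinarith [norm_nonneg ((U.det : intRing K) : K), norm_nonneg ((U'.det : intRing K) : K)]

lemma pow_mul_pow_le {x y : ℝ} (hx : 0 < x) (hxy : x ≤ y) {a b c d t : ℕ} (ha : c + t = a)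
    (hb : d = b + t) : x ^ a * y ^ b ≤ x ^ c * y ^ d := by
  subst ha hb
  have hy : 0 < y := hx.trans_le hxy
  calc x ^ (c + t) * y ^ b = x ^ c * (x ^ t * y ^ b) := by ring
    _ ≤ x ^ c * (y ^ t * y ^ b) := by gcongr
    _ = x ^ c * y ^ (b + t) := by ring

/-- The coefficients of a conjugate of a pair with semistable reduction are bounded below. -/
lemma norm_det_pow_le {e : ℕ} (he : 1 ≤ e)
    {P : MvPolynomial (Fin 2) K × MvPolynomial (Fin 2) K} (hP1 : P.1.IsHomogeneous e)
    (hP2 : P.2.IsHomogeneous e) (h1 : ∀ m, ‖P.1.coeff m‖ ≤ 1) (h2 : ∀ m, ‖P.2.coeff m‖ ≤ 1)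
    (hss : ¬Unstable e (redPoly K P.1) (redPoly K P.2)) {M M' : Matrix (Fin 2) (Fin 2) K}
    (hM : M * M' = 1) {N : ℝ} (hN1 : ∀ m, ‖(act M' M P).1.coeff m‖ ≤ N)
    (hN2 : ∀ m, ‖(act M' M P).2.coeff m‖ ≤ N) : ‖M.det‖ ^ (e - 1) ≤ N ^ 2 := by
  by_contra! hlt
  apply hss
  obtain ⟨U, U', V, V', hU, hV, δ, μ, hle, hUDV⟩ := exists_cartan_decomposition M
  have hN : 0 ≤ N := (norm_nonneg _).trans (hN1 0)
  have hdet : ‖M.det‖ = ‖δ‖ * ‖μ‖ := by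
    rw [hUDV, Matrix.det_mul, Matrix.det_mul, norm_mul, norm_mul, norm_det_eq_one hU,
      norm_det_eq_one hV]
    simp [Matrix.det_fin_two]
  have hM0 : M.det ≠ 0 := fun h0 => by
    have := congrArg Matrix.det hM
    rw [Matrix.det_mul, h0, zero_mul, Matrix.det_one] at this
    exact zero_ne_one this
  have hδ : 0 < ‖δ‖ := norm_pos_iff.mpr fun h0 => by
    simp [h0, hM0] at hdet
  have hμ : 0 < ‖μ‖ := hδ.trans_le hle
  have hδ0 : δ ≠ 0 := norm_pos_iff.mp hδ
  have hμ0 : μ ≠ 0 := norm_pos_iff.mp hμ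
  obtain ⟨P1, hP1'⟩ := exists_map_subtype_eq h1
  obtain ⟨P2, hP2'⟩ := exists_map_subtype_eq h2
  set ι := (intRing K).subtype with hι
  set Q := act U' U (P1, P2) with hQ
  have hPQ : act U U' Q = (P1, P2) := by
    rw [hQ, act_act, hU, act_one]
  have hQK : (map ι Q.1, map ι Q.2) = act (U'.map ι) (U.map ι) P := by
    rw [hQ, ← map_act, hP1', hP2']
  set D : Matrix (Fin 2) (Fin 2) K := !![δ, 0; 0, μ] with hD
  set D' : Matrix (Fin 2) (Fin 2) K := !![δ⁻¹, 0; 0, μ⁻¹] with hD'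
  have hDD : D' * D = 1 := by
    simp [hD, hD', Matrix.one_fin_two, hδ0, hμ0]
  have hconj : act (V.map ι) (V'.map ι) (act M' M P) = act D' D (map ι Q.1, map ι Q.2) := by
    rw [hQK, act_act, act_act]
    have eA : M * V'.map ι = U.map ι * D := by
      rw [hUDV, Matrix.mul_assoc, map_mul_map_eq_one ι hV, Matrix.mul_one]
    have eB : V.map ι * M' = D' * U'.map ι := by
      have : D' * U'.map ι * M * M' = V.map ι * M' := by
        rw [hUDV, Matrix.mul_assoc (D'), ← Matrix.mul_assoc (U'.map ι),
          ← Matrix.mul_assoc (U'.map ι), map_mul_map_eq_one ι (mul_eq_one_comm.mp hU), Matrix.one_mul,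
          ← Matrix.mul_assoc D', hDD, Matrix.one_mul]
      rw [← this, Matrix.mul_assoc, hM, Matrix.mul_one]
    rw [eA, eB]
  have hbound := norm_coeff_act_le V V' hN1 hN2
  rw [hconj] at hbound
  have hQhom := isHomogeneous_act U' U (P := (P1, P2)) (e := e)
    (IsHomogeneous.of_map_subtype (by rw [hP1']; exact hP1))
    (IsHomogeneous.of_map_subtype (by rw [hP2']; exact hP2))
  have hb1 : ∀ m, ‖δ‖ ^ m 0 * ‖μ‖ ^ m 1 * ‖((Q.1.coeff m : intRing K) : K)‖ ≤ ‖δ‖ * N := by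
    intro m
    have := (hbound m).1
    simp only [act, hD', Matrix.of_apply, Matrix.cons_val_zero, Matrix.cons_val_one,
      Matrix.cons_val', C_0, zero_mul, add_zero, coeff_C_mul, hD, coeff_linSubst_diagonal,
      norm_mul, norm_pow, norm_inv, coeff_map] at this
    rwa [inv_mul_le_iff₀ hδ] at this
  have hb2 : ∀ m, ‖δ‖ ^ m 0 * ‖μ‖ ^ m 1 * ‖((Q.2.coeff m : intRing K) : K)‖ ≤ ‖μ‖ * N := by
    intro m
    have := (hbound m).2
    simp only [act, hD', Matrix.of_apply, Matrix.cons_val_zero, Matrix.cons_val_one,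
      Matrix.cons_val', C_0, zero_mul, zero_add, coeff_C_mul, hD, coeff_linSubst_diagonal,
      norm_mul, norm_pow, norm_inv, coeff_map] at this
    rwa [inv_mul_le_iff₀ hμ] at this
  rw [hdet, mul_pow] at hlt
  have small : ∀ (x : ℝ) (m : Fin 2 →₀ ℕ) (c : K), 0 < x →
      ‖δ‖ ^ m 0 * ‖μ‖ ^ m 1 * ‖c‖ ≤ x * N →
      x ^ 2 * (‖δ‖ ^ (e - 1) * ‖μ‖ ^ (e - 1)) ≤ ‖δ‖ ^ (m 0 * 2) * ‖μ‖ ^ (m 1 * 2) → ‖c‖ < 1 := by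
    intro x m c hx hc hxy
    by_contra! hc1
    have e1 : ‖δ‖ ^ m 0 * ‖μ‖ ^ m 1 ≤ x * N := by
      refine le_trans ?_ hc
      exact le_mul_of_one_le_right (by positivity) hc1
    have e2 : (‖δ‖ ^ m 0 * ‖μ‖ ^ m 1) ^ 2 ≤ (x * N) ^ 2 := pow_le_pow_left₀ (by positivity) e1 2
    rw [mul_pow, ← pow_mul, ← pow_mul, mul_pow] at e2
    have e3 : x ^ 2 * N ^ 2 < x ^ 2 * (‖δ‖ ^ (e - 1) * ‖μ‖ ^ (e - 1)) :=
      mul_lt_mul_of_pos_left hlt (by positivity)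
    linarith
  have hr1 : X 0 ^ ((e + 1) / 2 + 1) ∣ map (resHom K) Q.1 := X_pow_dvd_of_coeff fun m hm => by
    by_contra h0
    have hsum := isHomogeneous_exponent_sum hQhom.1 (x := m) fun h => h0 (by
      rw [coeff_map, h, map_zero])
    rw [coeff_map, ← redCoeff_coe] at h0
    refine h0 (redCoeff_eq_zero (small ‖δ‖ m _ hδ (hb1 m) ?_))
    rw [← mul_assoc, ← pow_add]
    exact pow_mul_pow_le hδ hle (t := 2 + (e - 1) - m 0 * 2) (by omega) (by omega)
  have hr2 : X 0 ^ ((e + 1) / 2) ∣ map (resHom K) Q.2 := X_pow_dvd_of_coeff fun m hm => by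
    by_contra h0
    have hsum := isHomogeneous_exponent_sum hQhom.2 (x := m) fun h => h0 (by
      rw [coeff_map, h, map_zero])
    rw [coeff_map, ← redCoeff_coe] at h0
    refine h0 (redCoeff_eq_zero (small ‖μ‖ m _ hμ (hb2 m) ?_))
    rw [mul_left_comm, ← pow_add]
    exact pow_mul_pow_le hδ hle (t := e - 1 - m 0 * 2) (by omega) (by omega)
  have hUred := map_mul_map_eq_one (resHom K) hU
  have := (kk_isField (K := K)).nontrivial
  have hfin := unstable_act hUred (P := (map (resHom K) Q.1, map (resHom K) Q.2)) (e := e)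
    (by omega) hr1 hr2
  rwa [map_act, hPQ, ← redPoly_map, ← redPoly_map, ← hι, hP1', hP2'] at hfin

lemma conjPair_eq_act (M : GL (Fin 2) K) (F G : MvPolynomial (Fin 2) K) :
    conjPair K M F G = act (M⁻¹ : GL (Fin 2) K).1 M.1 (F, G) := rfl

/-- The resultant is minimal in the conjugacy class of a map with semistable reduction. -/
lemma Rmin_eq_Rpair [IsAlgClosed K] {e : ℕ} (he : 1 ≤ e) {F G : MvPolynomial (Fin 2) K}
    (hF : F.IsHomogeneous e) (hG : G.IsHomogeneous e) (hnorm : Normalized K F G)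
    (hres : bres e F G ≠ 0) (hss : ¬Unstable e (redPoly K F) (redPoly K G)) :
    Rmin K e F G = Rpair K e F G := by
  have hle : ∀ M : GL (Fin 2) K,
      Rpair K e F G ≤ Rpair K e (conjPair K M F G).1 (conjPair K M F G).2 := by
    intro M
    rw [conjPair_eq_act]
    have hM : M.1 * (M⁻¹ : GL (Fin 2) K).1 = 1 := M.mul_inv
    have hdet : M.1.det * (M⁻¹ : GL (Fin 2) K).1.det = 1 := by
      rw [← Matrix.det_mul, hM, Matrix.det_one]
    have hd0 : M.1.det ≠ 0 := left_ne_zero_of_mul_eq_one hdet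
    have hd1 : (M⁻¹ : GL (Fin 2) K).1.det ≠ 0 := right_ne_zero_of_mul_eq_one hdet
    have hord : ordv K (M⁻¹ : GL (Fin 2) K).1.det = -ordv K M.1.det := by
      have := congrArg (ordv K) hdet
      rw [ordv_mul hd0 hd1] at this
      have h1 : ordv K (1 : K) = 0 := by simp [ordv]
      linarith
    obtain ⟨h1, h2⟩ := isHomogeneous_act (M⁻¹ : GL (Fin 2) K).1 M.1 (P := (F, G)) hF hG
    have hb := bres_act (M⁻¹ : GL (Fin 2) K).1 M.1 (P := (F, G)) hF hG
    have hN := norm_coeff_le_maxNorm h1 h2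
    have hpow := norm_det_pow_le (P := (F, G)) he hF hG hnorm.1 hnorm.2.1 hss hM
      (fun m => (hN m).1) fun m => (hN m).2
    have hN0 := (norm_nonneg _).trans (hN 0).1
    rw [Rpair, Rpair, hnorm.maxNorm_eq_one hF hG, hb,
      ordv_mul (pow_ne_zero _ hd1) (mul_ne_zero hres (pow_ne_zero _ hd0)),
      ordv_mul hres (pow_ne_zero _ hd0), ordv_pow, ordv_pow, hord, Real.log_one]
    generalize maxNorm K e (act (M⁻¹ : GL (Fin 2) K).1 M.1 (F, G)).1
      (act (M⁻¹ : GL (Fin 2) K).1 M.1 (F, G)).2 = N at hpow hN0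
    have hlog := Real.log_le_log (pow_pos (norm_pos_iff.mpr hd0) _) hpow
    rw [Real.log_pow, Real.log_pow, Nat.cast_sub he] at hlog
    have := mul_le_mul_of_nonneg_left hlog (Nat.cast_nonneg (α := ℝ) e)
    simp only [ordv]
    push_cast at this ⊢
    linarith
  refine le_antisymm ?_ (le_ciInf hle)
  have h1 : conjPair K 1 F G = (F, G) := by
    rw [conjPair_eq_act, inv_one]
    exact act_one (F, G)
  refine (ciInf_le ⟨_, Set.forall_mem_range.mpr hle⟩ 1).trans ?_
  rw [h1]

end Minimality

/-- If for some `n ≥ 1` the iterate `φⁿ` has semistable reduction and the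
resultant iteration formula `R_{φⁿ} = N_n · R_φ` holds, then `φ` itself has semistable
reduction, and consequently the minimal resultant iteration formula
`R_{[φⁿ]} = N_n · R_{[φ]}` holds for this `n`. -/
theorem semistable_of_iterate_semistable {K : Type} [NontriviallyNormedField K]
    [IsAlgClosed K] [CompleteSpace K] [IsUltrametricDist K] (d : ℕ) (hd : 2 ≤ d)
    (F G : MvPolynomial (Fin 2) K) (hlift : LiftPair K d F G) (hnorm : Normalized K F G)
    (n : ℕ) (hn : 1 ≤ n)
    (hssn : HasSemistableRed K (d ^ n) (pairIter F G n).1 (pairIter F G n).2)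
    (hres : Rpair K (d ^ n) (pairIter F G n).1 (pairIter F G n).2 =
      ((d : ℝ) ^ n * ((d : ℝ) ^ n - 1) / ((d : ℝ) * ((d : ℝ) - 1))) * Rpair K d F G) :
    Semistable K d F G ∧
      Rmin K (d ^ n) (pairIter F G n).1 (pairIter F G n).2 =
        ((d : ℝ) ^ n * ((d : ℝ) ^ n - 1) / ((d : ℝ) * ((d : ℝ) - 1))) * Rmin K d F G := by
  obtain ⟨hF, hG, hrel⟩ := hlift
  have hres0 := bres_ne_zero_of_isRelPrime (by omega) hF hG hrel
  obtain ⟨hn0, hnord⟩ := ordv_bres_pairIter hd hF hG hres0 n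
  obtain ⟨hFn, hGn⟩ := isHomogeneous_pairIter hF hG n
  obtain ⟨hFint, hGint, -⟩ := id hnorm
  obtain ⟨hFnint, hGnint⟩ := norm_coeff_pairIter_le hFint hGint n
  obtain ⟨hred1, hred2⟩ := redPoly_pairIter hFint hGint n
  obtain ⟨c, hcnorm, A, F0, G0, e, -, -, -, -, hA1, hA2, hrel0, hcrit⟩ := hssn
  have hc0 : 0 < ‖(c : K)‖ := norm_pos_iff.mpr c.ne_zero
  have hlog : Real.log (maxNorm K (d ^ n) (pairIter F G n).1 (pairIter F G n).2) = 0 := by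
    rw [Rpair, Rpair, hnord, hnorm.maxNorm_eq_one hF hG, Real.log_one, mul_zero, add_zero] at hres
    have hdn : (2 : ℝ) * ((d ^ n : ℕ) : ℝ) ≠ 0 := by positivity
    exact (mul_eq_zero.mp (by linarith)).resolve_left hdn
  have hmax := norm_coeff_le_maxNorm hFn hGn
  have hcoeff : ∃ m, ‖(c : K)‖ * ‖(pairIter F G n).1.coeff m‖ = 1 ∨
      ‖(c : K)‖ * ‖(pairIter F G n).2.coeff m‖ = 1 := by
    simpa [norm_mul] using hcnorm.2.2
  have hpos : 0 < maxNorm K (d ^ n) (pairIter F G n).1 (pairIter F G n).2 := by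
    obtain ⟨m, hm | hm⟩ := hcoeff
    · exact (pos_of_mul_pos_right (hm ▸ one_pos) hc0.le).trans_le (hmax m).1
    · exact (pos_of_mul_pos_right (hm ▸ one_pos) hc0.le).trans_le (hmax m).2
  have hone := Real.eq_one_of_pos_of_log_eq_zero hpos hlog
  rw [hone] at hmax
  have hcle : ‖(c : K)‖ = 1 := by
    apply le_antisymm
    · rw [← inv_inv ‖(c : K)‖]
      refine inv_le_one_of_one_le₀ (hone.ge.trans (maxNorm_le _ (fun m => ?_) fun m => ?_))
      · rw [← one_div, le_div_iff₀' hc0]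
        simpa [norm_mul] using hcnorm.1 m
      · rw [← one_div, le_div_iff₀' hc0]
        simpa [norm_mul] using hcnorm.2.1 m
    · obtain ⟨m, hm | hm⟩ := hcoeff
      · exact hm.ge.trans (mul_le_of_le_one_right hc0.le (hmax m).1)
      · exact hm.ge.trans (mul_le_of_le_one_right hc0.le (hmax m).2)
  have hssn : ¬Unstable (d ^ n) (redPoly K (pairIter F G n).1) (redPoly K (pairIter F G n).2) := by
    intro h
    have h' := h.C_mul (redCoeff K c)
    rw [← redPoly_smul hcle.le hFnint, ← redPoly_smul hcle.le hGnint, hA1, hA2] at h'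
    exact kk_isField.not_unstable_of_decomposition hrel0 hcrit h'
  have hss : ¬Unstable d (redPoly K F) (redPoly K G) := by
    intro h
    apply hssn
    rw [hred1, hred2]
    exact kk_isField.unstable_pairIter (isHomogeneous_redPoly hF) (isHomogeneous_redPoly hG) h hn
  refine ⟨kk_isField.exists_semistable_decomposition (isHomogeneous_redPoly hF)
    (isHomogeneous_redPoly hG) hss, ?_⟩
  have hnormn : Normalized K (pairIter F G n).1 (pairIter F G n).2 := by
    refine ⟨hFnint, hGnint, ?_⟩
    simpa [hcle] using hcoeff
  rw [Rmin_eq_Rpair (Nat.one_le_pow _ _ (by omega)) hFn hGn hnormn hn0 hssn,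
    Rmin_eq_Rpair (by omega) hF hG hnorm hres0 hss, hres]

end
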